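/- arXiv:1201.6576 — 4 statements merged into one kernel-verified Lean document; each statement's English description precedes it below -/
import Mathlib

section
/- Let n ≥ 1 and let r_1, r_2, …, r_n be nonnegative integers with r_1 + 2r_2 + … + n·r_n = n, and set m = r_1 + r_2 + … + r_n. Then the number of non-crossing partitions π in NC(n) having exactly r_i blocks of size i for each i = 1, …, n equals n! / (r_1!·r_2!⋯r_n!·(n − m + 1)!); equivalently, (that number)·r_1!·r_2!⋯r_n!·(n − m + 1)! = n!. -/
open Finset

/-- A finpartition of `{0,…,n-1}` (representing `{1,…,n}`) is non-crossing if there are no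
`a < b < c < d` with `a, c` in one block and `b, d` in a different block. -/
def IsNoncrossing {n : ℕ} (π : Finpartition (Finset.univ : Finset (Fin n))) : Prop :=
  ∀ a b c d : Fin n, a < b → b < c → c < d →
    ∀ B ∈ π.parts, ∀ C ∈ π.parts, a ∈ B → c ∈ B → b ∈ C → d ∈ C → B = C

/-- Filter by an arbitrary (possibly non-decidable) predicate. -/
noncomputable def fil {α : Type*} (s : Finset α) (p : α → Prop) : Finset α :=
  letI := Classical.decPred p
  s.filter p

/-- `NC n` : the set of non-crossing partitions of `{1,…,n}`. -/
noncomputable def NC (n : ℕ) : Finset (Finpartition (Finset.univ : Finset (Fin n))) :=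
  fil Finset.univ IsNoncrossing

/-- `NCdiv k n` : the set of `k`-divisible non-crossing partitions of `{1,…,kn}`
(all blocks have size divisible by `k`). -/
noncomputable def NCdiv (k n : ℕ) : Finset (Finpartition (Finset.univ : Finset (Fin (k * n)))) :=
  fil Finset.univ (fun π => IsNoncrossing π ∧ ∀ B ∈ π.parts, k ∣ B.card)

/-- `NCeq k n` : the set of `k`-equal non-crossing partitions of `{1,…,kn}`
(all blocks have size exactly `k`). -/
noncomputable def NCeq (k n : ℕ) : Finset (Finpartition (Finset.univ : Finset (Fin (k * n)))) :=
  fil Finset.univ (fun π => IsNoncrossing π ∧ ∀ B ∈ π.parts, B.card = k)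

/-- The number of blocks of `π` of size `i`. -/
def blockCount {n : ℕ} (π : Finpartition (Finset.univ : Finset (Fin n))) (i : ℕ) : ℕ :=
  (π.parts.filter (fun B => B.card = i)).card

/-! ### Counting ballot words -/

/-- Ballot condition with starting height `h`. -/
def bal : ℕ → List ℕ → Prop
  | _, [] => True
  | h, k :: l => 1 ≤ h + k ∧ bal (h + k - 1) l

/-- Ballot words with a given multiset of letters. -/
noncomputable def BW (h : ℕ) (M : Multiset ℕ) : Finset (List ℕ) := fil M.lists.toFinset (bal h)

theorem mem_fil {α : Type*} (s : Finset α) (p : α → Prop) (x : α) :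
    x ∈ fil s p ↔ x ∈ s ∧ p x := by
  classical
  simp [fil]

theorem mem_BW (h : ℕ) (M : Multiset ℕ) (l : List ℕ) : l ∈ BW h M ↔ (l : Multiset ℕ) = M ∧ bal h l := by
  rw [BW, mem_fil, Multiset.mem_toFinset, Multiset.mem_lists_iff]
  simp [eq_comm]

theorem bal_iff (l : List ℕ) (h : ℕ) :
    bal h l ↔ ∀ j ≤ l.length, j ≤ h + (l.take j).sum := by
  induction l generalizing h with
  | nil => simp [bal]
  | cons k l ih =>
    simp only [bal, ih]
    constructor
    · rintro ⟨h1, h2⟩ j hj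
      cases j with
      | zero => simp
      | succ j =>
        have := h2 j (by simpa using hj)
        simp only [List.take_succ_cons, List.sum_cons]
        omega
    · intro H
      have h1 := H 1 (by simp)
      simp at h1
      refine ⟨h1, fun j hj => ?_⟩
      have := H (j+1) (by simpa using hj)
      simp only [List.take_succ_cons, List.sum_cons] at this
      omega

theorem card_BW_rec (h : ℕ) (M : Multiset ℕ) (hM : M ≠ 0) :
    (BW h M).card = ∑ k ∈ M.toFinset, if 1 ≤ h + k then (BW (h + k - 1) (M.erase k)).card else 0 := by
  classical
  have key : BW h M = (M.toFinset.filter (fun k => 1 ≤ h + k)).biUnion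
      (fun k => (BW (h + k - 1) (M.erase k)).image (List.cons k)) := by
    ext l
    simp only [mem_BW, mem_biUnion, Finset.mem_filter, Multiset.mem_toFinset, Finset.mem_image]
    constructor
    · rintro ⟨rfl, hb⟩
      cases l with
      | nil => simp at hM
      | cons k l =>
        exact ⟨k, ⟨by simp, hb.1⟩, l, ⟨by simp, hb.2⟩, rfl⟩
    · rintro ⟨k, ⟨hk, h1⟩, l', ⟨hl, hb⟩, rfl⟩
      refine ⟨?_, h1, hb⟩
      rw [← Multiset.cons_coe, hl, Multiset.cons_erase hk]
  rw [key, Finset.card_biUnion, Finset.sum_filter]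
  · refine Finset.sum_congr rfl fun k _ => ?_
    split_ifs
    · rw [Finset.card_image_of_injective _ (List.cons_injective)]
    · rfl
  · intro a _ b _ hab
    rw [Function.onFun, Finset.disjoint_left]
    intro l h1 h2
    simp only [Finset.mem_image] at h1 h2
    obtain ⟨_, _, rfl⟩ := h1
    obtain ⟨_, _, h3⟩ := h2
    exact hab (by simp at h3; exact h3.1.symm)

theorem prod_erase_mul (n : ℕ) (M : Multiset ℕ) (k : ℕ) (hk : k ∈ M) (hk1 : k ∈ Finset.Icc 1 n) :
    (∏ i ∈ Finset.Icc 1 n, (M.count i).factorial)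
      = M.count k * ∏ i ∈ Finset.Icc 1 n, ((M.erase k).count i).factorial := by
  rw [← Finset.mul_prod_erase _ _ hk1, ← Finset.mul_prod_erase _ _ hk1, ← mul_assoc]
  congr 1
  · rw [Multiset.count_erase_self, Nat.mul_factorial_pred]
    exact (Multiset.count_pos.2 hk).ne'
  · refine Finset.prod_congr rfl fun i hi => ?_
    rw [Multiset.count_erase_of_ne (Finset.ne_of_mem_erase hi)]

theorem card_BW (n : ℕ) (N : ℕ) : ∀ (h : ℕ) (M : Multiset ℕ), M.card = N → h + M.sum = N →
    (∀ k ∈ M, k ≤ n) →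
    (BW h M).card * (M.count 0 + 1).factorial * (∏ i ∈ Finset.Icc 1 n, (M.count i).factorial)
      = (h + 1) * N.factorial := by
  induction N with
  | zero =>
    intro h M hc hs _
    have hM : M = 0 := Multiset.card_eq_zero.1 hc
    subst hM
    have : BW h 0 = {[]} := by
      ext l
      rw [mem_BW]
      simp only [Multiset.coe_eq_zero, Finset.mem_singleton]
      constructor
      · exact fun h => h.1
      · rintro rfl; exact ⟨rfl, trivial⟩
    have hs : h = 0 := by simpa using hs
    subst hs
    simp [this]
  | succ N ih =>
    intro h M hc hs hle
    have hM : M ≠ 0 := by rintro rfl; simp at hc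
    rw [card_BW_rec h M hM, Finset.sum_mul, Finset.sum_mul]
    -- each term
    have term : ∀ k ∈ M.toFinset,
        (if 1 ≤ h + k then (BW (h + k - 1) (M.erase k)).card else 0) * (M.count 0 + 1).factorial *
          (∏ i ∈ Finset.Icc 1 n, (M.count i).factorial)
        = (M.count k * (h + k) + if k = 0 then h else 0) * N.factorial := by
      intro k hk
      rw [Multiset.mem_toFinset] at hk
      by_cases h1 : 1 ≤ h + k
      · rw [if_pos h1]
        have hc' : (M.erase k).card = N := by rw [Multiset.card_erase_of_mem hk, hc]; rfl
        have hs' : (M.erase k).sum + k = M.sum := by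
          conv_rhs => rw [← Multiset.cons_erase hk]
          simp [add_comm]
        have := ih (h + k - 1) (M.erase k) hc' (by omega)
          (fun j hj => hle j (Multiset.mem_of_mem_erase hj))
        rw [show h + k - 1 + 1 = h + k by omega] at this
        by_cases hk0 : k = 0
        · subst hk0
          rw [if_pos rfl]
          have e1 : (M.erase 0).count 0 + 1 = M.count 0 := by
            rw [Multiset.count_erase_self]
            have := Multiset.count_pos.2 hk
            omega
          have e2 : ∏ i ∈ Finset.Icc 1 n, ((M.erase 0).count i).factorial
              = ∏ i ∈ Finset.Icc 1 n, (M.count i).factorial := by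
            refine Finset.prod_congr rfl fun i hi => ?_
            rw [Multiset.count_erase_of_ne]
            simp at hi; omega
          rw [e1, e2] at this
          rw [Nat.factorial_succ]
          linear_combination (M.count 0 + 1) * this
        · rw [if_neg hk0]
          rw [prod_erase_mul n M k hk (by simp; exact ⟨by omega, hle k hk⟩)]
          rw [Multiset.count_erase_of_ne (Ne.symm hk0)] at this
          linear_combination (M.count k) * this
      · rw [if_neg h1]
        have : h = 0 := by omega
        have : k = 0 := by omega
        subst_vars
        simp
    rw [Finset.sum_congr rfl term, ← Finset.sum_mul, Finset.sum_add_distrib]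
    have s1 : ∑ k ∈ M.toFinset, M.count k * (h + k) = h * M.card + M.sum := by
      rw [← Multiset.toFinset_sum_count_eq, Finset.sum_multiset_count, Finset.mul_sum,
        ← Finset.sum_add_distrib]
      refine Finset.sum_congr rfl fun k _ => ?_
      simp; ring
    have s2 : (∑ k ∈ M.toFinset, if k = 0 then h else 0) = h := by
      rw [Finset.sum_ite_eq' ]
      split_ifs with h0
      · rfl
      · have : M.card ≤ M.sum := by
          have := Multiset.card_nsmul_le_sum (s := M) (a := 1) (fun x hx => by
            rw [Multiset.mem_toFinset] at h0
            rcases Nat.eq_zero_or_pos x with rfl | h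
            · exact absurd hx h0
            · exact h)
          simpa using this
        omega
    rw [s1, s2, Nat.factorial_succ, hc]
    have : h * (N+1) + M.sum + h = (h+1) * (N+1) := by
      linear_combination hs
    rw [this]; ring

/-! ### Leader functions -/

/-- Height of the path of a word. -/
def hgt (w : ℕ → ℕ) (j : ℕ) : ℤ := ∑ i ∈ Finset.range j, ((w i : ℤ) - 1)

/-- `q` is the leader of `p` for the word `w`. -/
def IsLead (w : ℕ → ℕ) (q p : ℕ) : Prop :=
  q ≤ p ∧ hgt w q ≤ hgt w (p + 1) ∧ ∀ x, q < x → x ≤ p → hgt w (p + 1) < hgt w x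

theorem IsLead.unique {w : ℕ → ℕ} {q q' p : ℕ} (h : IsLead w q p) (h' : IsLead w q' p) : q = q' := by
  rcases lt_trichotomy q q' with hl | hl | hl
  · have := h.2.2 q' hl h'.1
    have := h'.2.1
    omega
  · exact hl
  · have := h'.2.2 q hl h.1
    have := h.2.1
    omega

theorem hgt_congr {w w' : ℕ → ℕ} {n : ℕ} (h : ∀ i < n, w i = w' i) {j : ℕ} (hj : j ≤ n) :
    hgt w j = hgt w' j := by
  refine Finset.sum_congr rfl fun i hi => ?_
  rw [Finset.mem_range] at hi
  rw [h i (by omega)]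

theorem IsLead.congr {w w' : ℕ → ℕ} {n : ℕ} (h : ∀ i < n, w i = w' i) {q p : ℕ} (hp : p < n)
    (hl : IsLead w q p) : IsLead w' q p := by
  obtain ⟨h1, h2, h3⟩ := hl
  refine ⟨h1, ?_, fun x hx hx' => ?_⟩
  · rwa [← hgt_congr h (by omega), ← hgt_congr h (by omega)]
  · rw [← hgt_congr h (by omega), ← hgt_congr h (by omega)]
    exact h3 x hx hx'

/-- Fibre sizes. -/
def fib (n : ℕ) (f : ℕ → ℕ) (i : ℕ) : ℕ := ((Finset.range n).filter (fun x => f x = i)).card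

theorem hgt_sub (w : ℕ → ℕ) (a b : ℕ) (hab : a ≤ b) :
    hgt w b - hgt w a = ∑ i ∈ Finset.Ico a b, (w i : ℤ) - (b - a : ℤ) := by
  rw [hgt, hgt, ← Finset.sum_Ico_eq_sub _ hab, Finset.sum_sub_distrib]
  simp [Nat.cast_sub hab]

theorem sum_fib (n : ℕ) (f : ℕ → ℕ) (a b : ℕ) :
    ∑ i ∈ Finset.Ico a b, fib n f i
      = ((Finset.range n).filter (fun x => f x ∈ Finset.Ico a b)).card := by
  rw [Finset.card_eq_sum_card_fiberwise (f := f) (t := Finset.Ico a b)]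
  · refine Finset.sum_congr rfl fun i hi => ?_
    rw [fib, Finset.filter_filter]
    congr 1
    ext x
    simp only [Finset.mem_filter]
    constructor
    · rintro ⟨h, rfl⟩; exact ⟨h, hi, rfl⟩
    · rintro ⟨h, _, h'⟩; exact ⟨h, h'⟩
  · intro x hx
    simpa using (by simpa using hx : x < n ∧ a ≤ f x ∧ f x < b).2

/-- Noncrossing leader functions. -/
structure NCF (n : ℕ) (f : ℕ → ℕ) : Prop where
  le : ∀ x < n, f x ≤ x
  idem : ∀ x < n, f (f x) = f x
  nc : ∀ a b c d, a < b → b < c → c < d → d < n → f a = f c → f b = f d → f a = f b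

theorem NCF.isLead {n : ℕ} {f : ℕ → ℕ} (hf : NCF n f) {p : ℕ} (hp : p < n) :
    IsLead (fib n f) (f p) p := by
  have hle := hf.le p hp
  refine ⟨hle, ?_, ?_⟩
  · have h1 := hgt_sub (fib n f) (f p) (p+1) (by omega)
    have h2 := sum_fib n f (f p) (p+1)
    have h3 : (Finset.Ico (f p) (p+1)).card ≤
        ((Finset.range n).filter (fun x => f x ∈ Finset.Ico (f p) (p+1))).card := by
      refine Finset.card_le_card fun x hx => ?_
      simp only [Finset.mem_Ico, Finset.mem_filter, Finset.mem_range] at hx ⊢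
      have hx1 := hf.le x (by omega)
      refine ⟨by omega, ?_, by omega⟩
      by_contra hlt
      push Not at hlt
      -- f x < f p < x < p
      have a1 : f p ≠ x := fun h => by
        have := hf.idem p hp
        rw [h] at this; omega
      have a2 : x ≠ p := fun h => by rw [h] at hlt; omega
      have := hf.nc (f x) (f p) x p hlt (by omega) (by omega) hp (hf.idem x (by omega)) (hf.idem p hp)
      rw [hf.idem x (by omega), hf.idem p hp] at this
      omega
    rw [← h2, Nat.card_Ico] at h3
    zify [show f p ≤ p + 1 by omega] at h3
    push_cast at h1
    linarith
  · intro q hq hqp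
    have h1 := hgt_sub (fib n f) q (p+1) (by omega)
    have h2 := sum_fib n f q (p+1)
    have h3 : ((Finset.range n).filter (fun x => f x ∈ Finset.Ico q (p+1))).card <
        (Finset.Ico q (p+1)).card := by
      refine Finset.card_lt_card ?_
      rw [Finset.ssubset_iff_of_subset]
      · refine ⟨p, by simp; omega, ?_⟩
        simp only [Finset.mem_Ico, Finset.mem_filter, Finset.mem_range]
        omega
      · intro x hx
        simp only [Finset.mem_Ico, Finset.mem_filter, Finset.mem_range] at hx ⊢
        have hx1 := hf.le x (by omega)
        refine ⟨by omega, ?_⟩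
        by_contra hlt
        have a1 : f x ≠ p := fun h => by
          have := hf.idem x hx.1
          rw [h] at this; omega
        have := hf.nc (f p) (f x) p x (by omega) (by omega) (by omega) hx.1
          (hf.idem p hp) (hf.idem x hx.1)
        rw [hf.idem x (by omega), hf.idem p hp] at this
        omega
    rw [← h2, Nat.card_Ico] at h3
    zify [show q ≤ p + 1 by omega] at h3
    push_cast at h1
    linarith

theorem NCF.ballot {n : ℕ} {f : ℕ → ℕ} (hf : NCF n f) {j : ℕ} (hj : j ≤ n) :
    j ≤ ∑ i ∈ Finset.range j, fib n f i := by
  rw [Finset.range_eq_Ico, sum_fib]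
  calc j = (Finset.range j).card := by simp
    _ ≤ _ := by
      refine Finset.card_le_card fun x hx => ?_
      simp only [Finset.mem_Ico, Finset.mem_filter, Finset.mem_range] at hx ⊢
      have := hf.le x (by omega)
      omega

theorem exists_lead {w : ℕ → ℕ} {n : ℕ} (hb : ∀ j ≤ n, 0 ≤ hgt w j) (p : ℕ) (hp : p < n) :
    ∃ q, IsLead w q p := by
  classical
  refine ⟨Nat.findGreatest (fun q => hgt w q ≤ hgt w (p+1)) p, Nat.findGreatest_le _, ?_, ?_⟩
  · refine Nat.findGreatest_spec (P := fun q => hgt w q ≤ hgt w (p+1)) (Nat.zero_le p) ?_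
    have := hb (p+1) hp
    simpa [hgt] using this
  · intro x hx hxp
    have := Nat.findGreatest_is_greatest hx hxp
    omega

theorem hgt_succ (w : ℕ → ℕ) (j : ℕ) : hgt w (j+1) = hgt w j + w j - 1 := by
  rw [hgt, Finset.sum_range_succ, ← hgt]; ring

theorem NCF_of_lead {w : ℕ → ℕ} {n : ℕ} {f : ℕ → ℕ} (hf : ∀ p < n, IsLead w (f p) p) : NCF n f := by
  refine ⟨fun x hx => (hf x hx).1, ?_, ?_⟩
  · intro p hp
    obtain ⟨h1, h2, h3⟩ := hf p hp
    rcases h1.eq_or_lt with h | h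
    · rw [h, h]
    · refine (hf (f p) (by omega)).unique ⟨le_rfl, ?_, fun x _ _ => by omega⟩
      have := h3 (f p + 1) (by omega) (by omega)
      omega
  · intro a b c d hab hbc hcd hd hac hbd
    have ha := hf a (by omega)
    have hb := hf b (by omega)
    have hc := hf c (by omega)
    have hd := hf d (by omega)
    rw [← hac] at hc
    rw [← hbd] at hd
    rcases lt_trichotomy (f a) (f b) with hl | hl | hl
    · have h1 := hc.2.2 (f b) hl (by have := hb.1; omega)
      have h2 := hd.2.2 (c+1) (by have := hb.1; omega) (by omega)
      have h3 := hd.2.1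
      omega
    · exact hl
    · have h1 := hb.2.2 (f a) hl (by have := ha.1; omega)
      have h2 := hc.2.2 (b+1) (by have := ha.1; omega) (by omega)
      have h3 := hc.2.1
      omega

theorem fib_le {w : ℕ → ℕ} {n : ℕ} {f : ℕ → ℕ} (hf : ∀ p < n, IsLead w (f p) p) (q : ℕ) :
    fib n f q ≤ w q := by
  have : ((Finset.range n).filter (fun x => f x = q)).card ≤ (Finset.Ico (0:ℤ) (w q)).card := by
    refine Finset.card_le_card_of_injOn (fun p => hgt w (p+1) - hgt w q) ?_ ?_
    · intro p hp
      simp at hp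
      obtain ⟨hp, rfl⟩ := hp
      have := hf p hp
      simp only [Finset.coe_Ico, Set.mem_Ico]
      refine ⟨by have := this.2.1; omega, ?_⟩
      have h2 := hgt_succ w (f p)
      rcases this.1.eq_or_lt with h | h
      · rw [h] at h2 ⊢; omega
      · have := this.2.2 (f p + 1) (by omega) (by omega)
        omega
    · intro p hp p' hp' heq
      simp at hp hp' heq
      have l1 := hf p hp.1
      have l2 := hf p' hp'.1
      rw [hp.2] at l1
      rw [hp'.2] at l2
      rcases lt_trichotomy p p' with h | h | h
      · have := l2.2.2 (p+1) (by have := l1.1; omega) (by omega)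
        omega
      · exact h
      · have := l1.2.2 (p'+1) (by have := l2.1; omega) (by omega)
        omega
  simpa [fib] using this

theorem fib_eq {w : ℕ → ℕ} {n : ℕ} {f : ℕ → ℕ} (hf : ∀ p < n, IsLead w (f p) p)
    (hw : ∑ i ∈ Finset.range n, w i = n) : ∀ i < n, fib n f i = w i := by
  have h1 : ∑ i ∈ Finset.range n, fib n f i = n := by
    rw [Finset.range_eq_Ico, sum_fib, Finset.filter_true_of_mem]
    · simp
    · intro x hx
      simp only [Finset.mem_Ico, Finset.mem_range] at hx ⊢
      have := (hf x hx).1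
      omega
  have := (Finset.sum_eq_sum_iff_of_le (s := Finset.range n) (fun i _ => fib_le hf i)).1 (h1.trans hw.symm)
  intro i hi
  exact this i (by simpa using hi)

/-! ### From partitions to leader functions -/

theorem part_ne {n : ℕ} (π : Finpartition (Finset.univ : Finset (Fin n))) (x : Fin n) :
    (π.part x).Nonempty := π.part_nonempty.2 (Finset.mem_univ x)

/-- The minimum of the block of `x`. -/
def mn {n : ℕ} (π : Finpartition (Finset.univ : Finset (Fin n))) (x : Fin n) : Fin n :=
  (π.part x).min' (part_ne π x)

/-- The leader function of a partition. -/
def lf {n : ℕ} (π : Finpartition (Finset.univ : Finset (Fin n))) (x : ℕ) : ℕ :=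
  if h : x < n then (mn π ⟨x, h⟩ : ℕ) else x

section
variable {n : ℕ} (π : Finpartition (Finset.univ : Finset (Fin n)))

theorem mn_mem (x : Fin n) : mn π x ∈ π.part x := Finset.min'_mem _ _

theorem mn_le (x : Fin n) : mn π x ≤ x :=
  Finset.min'_le _ _ (π.mem_part_self.2 (Finset.mem_univ x))

theorem mn_congr {x y : Fin n} (h : π.part x = π.part y) : mn π x = mn π y := by
  simp only [mn, h]

theorem part_mn (x : Fin n) : π.part (mn π x) = π.part x :=
  π.part_eq_of_mem (π.part_mem.2 (Finset.mem_univ x)) (mn_mem π x)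

theorem mn_eq_iff {x y : Fin n} : mn π x = mn π y ↔ π.part x = π.part y := by
  refine ⟨fun h => ?_, mn_congr π⟩
  rw [← part_mn π x, h, part_mn]

theorem mem_part_iff_mn {x y : Fin n} : y ∈ π.part x ↔ mn π y = mn π x := by
  rw [mn_eq_iff, π.part_eq_iff_mem (π.part_mem.2 (Finset.mem_univ x))]

theorem lf_val (x : Fin n) : lf π x = (mn π x : ℕ) := by simp [lf]

theorem lf_eq_iff {x y : Fin n} : lf π x = lf π y ↔ π.part x = π.part y := by
  rw [lf_val, lf_val, ← mn_eq_iff, Fin.ext_iff]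

theorem NCF_lf (h : IsNoncrossing π) : NCF n (lf π) := by
  refine ⟨fun x hx => ?_, fun x hx => ?_, ?_⟩
  · have := mn_le π ⟨x, hx⟩
    rw [lf, dif_pos hx]
    exact this
  · have h1 := lf_val π ⟨x, hx⟩
    simp only at h1
    rw [h1, lf_val, mn_congr π (part_mn π ⟨x, hx⟩)]
  · intro a b c d hab hbc hcd hd hac hbd
    have e1 := (lf_eq_iff π (x := ⟨a, by omega⟩) (y := ⟨c, by omega⟩)).1 hac
    have e2 := (lf_eq_iff π (x := ⟨b, by omega⟩) (y := ⟨d, by omega⟩)).1 hbd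
    refine (lf_eq_iff π (x := ⟨a, by omega⟩) (y := ⟨b, by omega⟩)).2 ?_
    refine h ⟨a, by omega⟩ ⟨b, by omega⟩ ⟨c, by omega⟩ ⟨d, by omega⟩ hab hbc hcd _
      (π.part_mem.2 (Finset.mem_univ _)) _ (π.part_mem.2 (Finset.mem_univ _)) ?_ ?_ ?_ ?_
    · exact π.mem_part_self.2 (Finset.mem_univ _)
    · rw [e1]; exact π.mem_part_self.2 (Finset.mem_univ _)
    · exact π.mem_part_self.2 (Finset.mem_univ _)
    · rw [e2]; exact π.mem_part_self.2 (Finset.mem_univ _)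

theorem fib_lf (x : Fin n) : fib n (lf π) (mn π x) = (π.part x).card := by
  rw [fib]
  refine (Finset.card_bij (fun (y : Fin n) _ => (y : ℕ)) ?_ ?_ ?_).symm
  · intro y hy
    rw [mem_part_iff_mn] at hy
    simp [lf_val, hy]
  · intro a _ b _ h
    exact Fin.ext h
  · intro y hy
    simp only [Finset.mem_filter, Finset.mem_range] at hy
    refine ⟨⟨y, hy.1⟩, ?_, rfl⟩
    rw [mem_part_iff_mn, Fin.ext_iff, ← lf_val]
    exact hy.2

theorem blockCount_eq (k : ℕ) (hk : 1 ≤ k) :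
    blockCount π k = ((Finset.range n).filter (fun i => fib n (lf π) i = k)).card := by
  rw [blockCount]
  refine Finset.card_bij (fun B hB => ((B.min' (π.nonempty_of_mem_parts
    (Finset.mem_filter.1 hB).1) : Fin n) : ℕ)) ?_ ?_ ?_
  · intro B hB
    have hB' := Finset.mem_filter.1 hB
    obtain ⟨x, hx⟩ := π.nonempty_of_mem_parts hB'.1
    have := π.part_eq_of_mem hB'.1 hx
    subst this
    simp only [Finset.mem_filter, Finset.mem_range, Fin.is_lt, true_and]
    exact (fib_lf π x).trans hB'.2
  · intro B hB C hC h
    have hB' := Finset.mem_filter.1 hB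
    have hC' := Finset.mem_filter.1 hC
    have h' := Fin.ext h
    have m1 := Finset.min'_mem B (π.nonempty_of_mem_parts hB'.1)
    have m2 := Finset.min'_mem C (π.nonempty_of_mem_parts hC'.1)
    rw [h'] at m1
    exact π.eq_of_mem_parts hB'.1 hC'.1 m1 m2
  · intro i hi
    simp only [Finset.mem_filter, Finset.mem_range] at hi
    have : 0 < fib n (lf π) i := by omega
    rw [fib, Finset.card_pos] at this
    obtain ⟨x, hx⟩ := this
    simp only [Finset.mem_filter, Finset.mem_range] at hx
    have e : (mn π ⟨x, hx.1⟩ : ℕ) = i := by rw [← lf_val]; exact hx.2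
    refine ⟨π.part ⟨x, hx.1⟩, ?_, e⟩
    rw [Finset.mem_filter]
    refine ⟨π.part_mem.2 (Finset.mem_univ _), ?_⟩
    rw [← fib_lf, e, hi.2]

end

theorem eq_of_lf {n : ℕ} (π π' : Finpartition (Finset.univ : Finset (Fin n)))
    (h : ∀ x < n, lf π x = lf π' x) : π = π' := by
  have hp : ∀ x : Fin n, π.part x = π'.part x := by
    intro x
    ext y
    rw [mem_part_iff_mn, mem_part_iff_mn, Fin.ext_iff, Fin.ext_iff, ← lf_val, ← lf_val, ← lf_val,
      ← lf_val, h _ x.2, h _ y.2]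
  apply Finpartition.ext
  ext B
  constructor
  · intro hB
    obtain ⟨x, hx⟩ := π.nonempty_of_mem_parts hB
    rw [← π.part_eq_of_mem hB hx, hp]
    exact π'.part_mem.2 (Finset.mem_univ _)
  · intro hB
    obtain ⟨x, hx⟩ := π'.nonempty_of_mem_parts hB
    rw [← π'.part_eq_of_mem hB hx, ← hp]
    exact π.part_mem.2 (Finset.mem_univ _)

theorem exists_partition {n : ℕ} {f : ℕ → ℕ} (hf : NCF n f) :
    ∃ π : Finpartition (Finset.univ : Finset (Fin n)), IsNoncrossing π ∧ ∀ x < n, lf π x = f x := by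
  classical
  let s : Setoid (Fin n) := Setoid.ker (fun x : Fin n => f x)
  let π := Finpartition.ofSetoid s
  have hmem : ∀ x y : Fin n, y ∈ π.part x ↔ f x = f y := by
    intro x y
    exact Finpartition.mem_part_ofSetoid_iff_rel
  refine ⟨π, ?_, ?_⟩
  · intro a b c d hab hbc hcd B hB C hC ha hc hb hd
    have e1 := π.part_eq_of_mem hB ha
    have e2 := π.part_eq_of_mem hC hb
    rw [← e1] at hc
    rw [← e2] at hd
    have := hf.nc a b c d hab hbc hcd d.2 ((hmem a c).1 hc) ((hmem b d).1 hd)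
    have h3 := (hmem a b).2 this
    rw [← e2, π.part_eq_of_mem hB (by rwa [e1] at h3)]
  · intro x hx
    rw [lf, dif_pos hx]
    have hle := hf.le x hx
    have h1 : (⟨f x, by omega⟩ : Fin n) ∈ π.part ⟨x, hx⟩ := by
      rw [hmem]; exact (hf.idem x hx).symm
    have h2 : mn π ⟨x, hx⟩ ≤ (⟨f x, by omega⟩ : Fin n) := Finset.min'_le _ _ h1
    have h3 := mn_mem π ⟨x, hx⟩
    rw [hmem] at h3
    have h4 := hf.le (mn π ⟨x, hx⟩) (mn π ⟨x, hx⟩).2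
    have h5 : (mn π ⟨x, hx⟩ : ℕ) ≤ f x := h2
    simp only at h3
    omega

/-! ### Words -/

/-- The word of `w` restricted to `{0,…,n-1}`. -/
def wd (n : ℕ) (w : ℕ → ℕ) : List ℕ := (List.range n).map w

theorem wd_take_sum (n : ℕ) (w : ℕ → ℕ) (j : ℕ) (hj : j ≤ n) :
    ((wd n w).take j).sum = ∑ i ∈ Finset.range j, w i := by
  rw [wd, ← List.map_take, List.take_range, min_eq_left hj, Finset.sum_range]
  rw [← List.sum_ofFn, List.ofFn_eq_map, ← List.map_coe_finRange_eq_range, List.map_map]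
  rfl

theorem bal_wd (n : ℕ) (w : ℕ → ℕ) :
    bal 0 (wd n w) ↔ ∀ j ≤ n, j ≤ ∑ i ∈ Finset.range j, w i := by
  rw [bal_iff]
  have : (wd n w).length = n := by simp [wd]
  rw [this]
  refine forall₂_congr fun j hj => ?_
  rw [wd_take_sum n w j hj, zero_add]

theorem wd_count (n : ℕ) (w : ℕ → ℕ) (k : ℕ) :
    (wd n w).count k = ((Finset.range n).filter (fun i => w i = k)).card := by
  rw [wd, List.count_eq_countP, List.countP_map, Finset.card_filter]
  induction n with
  | zero => simp
  | succ n ih =>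
    rw [List.range_succ, List.countP_append, ih, Finset.sum_range_succ]
    simp [List.countP_cons]

theorem wd_congr {n : ℕ} {w w' : ℕ → ℕ} : wd n w = wd n w' ↔ ∀ i < n, w i = w' i := by
  simp [wd]

theorem exists_wd {n : ℕ} (l : List ℕ) (hl : l.length = n) : ∃ w, l = wd n w := by
  refine ⟨fun i => l.getD i 0, ?_⟩
  apply List.ext_getElem
  · simp [wd, hl]
  · intro i h1 h2
    simp [wd, h1]

theorem hgt_eq (w : ℕ → ℕ) (j : ℕ) : hgt w j = ((∑ i ∈ Finset.range j, w i : ℕ) : ℤ) - j := by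
  simp [hgt]

theorem multiset_eq {M M' : Multiset ℕ} (hc : M.card = M'.card)
    (h : ∀ k, 1 ≤ k → M.count k = M'.count k) : M = M' := by
  have h1 : M.filter (fun k => ¬ (0 = k)) = M'.filter (fun k => ¬ (0 = k)) := by
    ext k
    rw [Multiset.count_filter, Multiset.count_filter]
    split_ifs with hk
    · rfl
    · exact h k (by omega)
  have e1 := congrArg Multiset.card (Multiset.filter_add_not (fun k => 0 = k) M)
  have e2 := congrArg Multiset.card (Multiset.filter_add_not (fun k => 0 = k) M')
  rw [Multiset.card_add] at e1 e2
  rw [h1] at e1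
  ext k
  rcases Nat.eq_zero_or_pos k with rfl | hk
  · rw [Multiset.count_eq_card_filter_eq, Multiset.count_eq_card_filter_eq]
    omega
  · exact h k hk

/-- The multiset of letters. -/
def letters (n : ℕ) (r : ℕ → ℕ) (z : ℕ) : Multiset ℕ :=
  ∑ i ∈ Finset.Icc 1 n, Multiset.replicate (r i) i + Multiset.replicate z 0

theorem letters_count (n : ℕ) (r : ℕ → ℕ) (z k : ℕ) :
    (letters n r z).count k = (if k ∈ Finset.Icc 1 n then r k else 0) + if k = 0 then z else 0 := by
  rw [letters, Multiset.count_add, Multiset.count_sum']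
  simp only [Multiset.count_replicate]
  rw [Finset.sum_ite_eq']
  simp [eq_comm]

theorem blockCount_large {n : ℕ} (π : Finpartition (Finset.univ : Finset (Fin n))) (k : ℕ)
    (hk : n < k) : blockCount π k = 0 := by
  rw [blockCount, Finset.card_eq_zero, Finset.filter_eq_empty_iff]
  intro B _ h
  have := Finset.card_le_univ B
  simp at this
  omega

theorem card_eq_BW (n : ℕ) (r : ℕ → ℕ)
    (hsum : ∑ i ∈ Finset.Icc 1 n, i * r i = n)
    (m : ℕ) (hm : m = ∑ i ∈ Finset.Icc 1 n, r i) (hmn : m ≤ n) :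
    (fil (NC n) (fun π => ∀ i ∈ Finset.Icc 1 n, blockCount π i = r i)).card
      = (BW 0 (letters n r (n - m))).card := by
  have hcard : (letters n r (n - m)).card = n := by
    simp [letters, ← hm]; omega
  have hMsum : (letters n r (n - m)).sum = n := by
    simp only [letters, Multiset.sum_add, Multiset.sum_sum, Multiset.sum_replicate, smul_eq_mul,
      mul_zero, add_zero]
    conv_rhs => rw [← hsum]
    exact Finset.sum_congr rfl (fun i _ => mul_comm _ _)
  refine Finset.card_bij (fun π _ => wd n (fib n (lf π))) ?_ ?_ ?_
  · intro π hπ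
    rw [mem_fil, NC, mem_fil] at hπ
    obtain ⟨⟨-, hnc⟩, hr⟩ := hπ
    rw [mem_BW, bal_wd]
    refine ⟨multiset_eq ?_ ?_, fun j hj => (NCF_lf π hnc).ballot hj⟩
    · rw [hcard]; simp [wd]
    · intro k hk
      rw [Multiset.coe_count, wd_count, ← blockCount_eq π k hk, letters_count, if_neg (by omega : ¬ k = 0)]
      split_ifs with h
      · exact hr k h
      · exact blockCount_large π k (by simp at h; omega)
  · intro π hπ π' hπ' h
    rw [mem_fil, NC, mem_fil] at hπ hπ'
    rw [wd_congr] at h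
    refine eq_of_lf π π' fun x hx => ?_
    exact (((NCF_lf π hπ.1.2).isLead hx).congr h hx).unique ((NCF_lf π' hπ'.1.2).isLead hx)
  · intro l hl
    rw [mem_BW] at hl
    obtain ⟨hl, hb⟩ := hl
    obtain ⟨w, rfl⟩ := exists_wd (n := n) l (by rw [← Multiset.coe_card, hl, hcard])
    rw [bal_wd] at hb
    have hws : ∑ i ∈ Finset.range n, w i = n := by
      rw [← wd_take_sum n w n le_rfl, List.take_of_length_le (by simp [wd]), ← Multiset.sum_coe, hl, hMsum]
    have hex : ∀ p, ∃ q, p < n → IsLead w q p := by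
      intro p
      by_cases hp : p < n
      · obtain ⟨q, hq⟩ := exists_lead (w := w) (n := n) (fun j hj => by
          rw [hgt_eq]; have := hb j hj; omega) p hp
        exact ⟨q, fun _ => hq⟩
      · exact ⟨0, fun h => absurd h hp⟩
    choose f hf using hex
    obtain ⟨π, hnc, hπ⟩ := exists_partition (NCF_of_lead hf)
    have hw : ∀ i < n, fib n (lf π) i = w i := by
      apply fib_eq _ hws
      intro p hp
      rw [hπ p hp]
      exact hf p hp
    have hwd : wd n (fib n (lf π)) = wd n w := wd_congr.2 hw
    refine ⟨π, ?_, hwd⟩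
    rw [mem_fil, NC, mem_fil]
    refine ⟨⟨Finset.mem_univ _, hnc⟩, fun k hk => ?_⟩
    have hk1 : 1 ≤ k := (Finset.mem_Icc.1 hk).1
    rw [blockCount_eq π k hk1, ← wd_count, hwd, ← Multiset.coe_count, hl, letters_count, if_pos hk,
      if_neg (by omega), add_zero]


/-- **Kreweras' formula.** For `r_1 + 2 r_2 + ⋯ + n r_n = n` and `m = r_1 + ⋯ + r_n`,
the number of non-crossing partitions of `{1,…,n}` with exactly `r_i` blocks of size `i`
for each `i = 1,…,n` equals `n! / (r_1! ⋯ r_n! (n - m + 1)!)`. -/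
theorem expected_number_of_blocks_of_given_type (n : ℕ) (hn : 1 ≤ n) (r : ℕ → ℕ)
    (hsum : ∑ i ∈ Finset.Icc 1 n, i * r i = n)
    (m : ℕ) (hm : m = ∑ i ∈ Finset.Icc 1 n, r i) :
    (fil (NC n) (fun π => ∀ i ∈ Finset.Icc 1 n, blockCount π i = r i)).card *
        (∏ i ∈ Finset.Icc 1 n, Nat.factorial (r i)) * Nat.factorial (n - m + 1) =
      Nat.factorial n := by
  have hmn : m ≤ n := by
    rw [hm]
    conv_rhs => rw [← hsum]
    refine Finset.sum_le_sum fun i hi => ?_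
    exact Nat.le_mul_of_pos_left _ (Finset.mem_Icc.1 hi).1
  have hcard : (letters n r (n - m)).card = n := by
    simp [letters, ← hm]; omega
  have hMsum : (letters n r (n - m)).sum = n := by
    simp only [letters, Multiset.sum_add, Multiset.sum_sum, Multiset.sum_replicate, smul_eq_mul,
      mul_zero, add_zero]
    conv_rhs => rw [← hsum]
    exact Finset.sum_congr rfl (fun i _ => mul_comm _ _)
  have key := card_BW n n 0 (letters n r (n - m)) hcard (by rw [hMsum, zero_add]) (by
    intro k hk
    have := Multiset.count_pos.2 hk
    rw [letters_count] at this
    by_contra hlt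
    rw [if_neg (by simp; omega), if_neg (by omega)] at this
    omega)
  rw [card_eq_BW n r hsum m hm hmn]
  have e0 : (letters n r (n - m)).count 0 = n - m := by
    rw [letters_count]; simp
  have e1 : ∏ i ∈ Finset.Icc 1 n, ((letters n r (n - m)).count i).factorial
      = ∏ i ∈ Finset.Icc 1 n, (r i).factorial := by
    refine Finset.prod_congr rfl fun i hi => ?_
    rw [letters_count, if_pos hi, if_neg (by simp at hi; omega), add_zero]
  rw [e0, e1] at key
  linarith
end

section
/- For all integers n ≥ 1 and k ≥ 1, the number of elements of NC^k(n) equals binom((k+1)n, n)/(kn+1); equivalently, (kn+1)·#NC^k(n) = binom((k+1)n, n). -/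
open Finset

/-- Partial sums of the periodic extension of `a`. -/
def psum {N : ℕ} (a : Fin (N + 1) → ℕ) (j : ℕ) : ℕ :=
  ∑ l ∈ Finset.range j, a (Fin.ofNat (N + 1) l)

/-- Rotation. -/
def rotF {N : ℕ} (r : Fin (N + 1)) (a : Fin (N + 1) → ℕ) : Fin (N + 1) → ℕ := fun i => a (i + r)

/-- Good (Lukasiewicz type) sequences. -/
def goodF (k : ℕ) {N : ℕ} (a : Fin (N + 1) → ℕ) : Prop := ∀ j ≤ N, j ≤ k * psum a j

lemma psum_rot {N : ℕ} (r : Fin (N + 1)) (a : Fin (N + 1) → ℕ) (j : ℕ) :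
    psum a (r + j) = psum a r + psum (rotF r a) j := by
  unfold psum rotF
  rw [Finset.sum_range_add]
  congr 1
  refine Finset.sum_congr rfl fun l _ => ?_
  congr 1
  ext
  simp [Fin.val_add, add_comm]

lemma psum_full {N : ℕ} (a : Fin (N + 1) → ℕ) : psum a (N + 1) = ∑ i, a i := by
  unfold psum
  rw [← Fin.sum_univ_eq_sum_range (fun l => a (Fin.ofNat (N + 1) l))]
  refine Finset.sum_congr rfl fun l _ => ?_
  congr 1
  ext
  simp

lemma psum_period {N : ℕ} (a : Fin (N + 1) → ℕ) (j : ℕ) :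
    psum a (j + (N + 1)) = psum a j + ∑ i, a i := by
  rw [← psum_full]
  unfold psum
  rw [add_comm j, Finset.sum_range_add, add_comm]
  congr 1
  refine Finset.sum_congr rfl fun l _ => ?_
  congr 1
  ext
  simp

lemma sum_rot {N : ℕ} (r : Fin (N + 1)) (a : Fin (N + 1) → ℕ) : ∑ i, rotF r a i = ∑ i, a i :=
  Equiv.sum_comp (Equiv.addRight r) a

lemma good_rot_iff (k : ℕ) {N : ℕ} (r : Fin (N + 1)) (a : Fin (N + 1) → ℕ) :
    goodF k (rotF r a) ↔ ∀ j ≤ N, k * psum a r + j ≤ k * psum a (r + j) := by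
  unfold goodF
  refine forall₂_congr fun j _ => ?_
  rw [psum_rot, mul_add]
  omega

lemma existsUnique_good (k n : ℕ) (a : Fin (k * n + 1) → ℕ) (ha : ∑ i, a i = n) :
    ∃! r : Fin (k * n + 1), goodF k (rotF r a) := by
  simp only [good_rot_iff]
  have per := psum_period a
  rw [ha] at per
  have per' : ∀ j, k * psum a (j + (k * n + 1)) = k * psum a j + k * n := by
    intro j; rw [per, mul_add]
  generalize hN : k * n = N at *
  let H : ℕ → ℤ := fun j => (k * psum a j : ℕ) - (j : ℤ)
  have hH : ∀ j, H j = (k * psum a j : ℕ) - (j : ℤ) := fun _ => rfl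
  have perH : ∀ j, H (j + (N + 1)) = H j - 1 := by
    intro j; rw [hH, hH, per']; push_cast; ring
  have key : ∀ r j, (k * psum a r + j ≤ k * psum a (r + j)) ↔ H r ≤ H (r + j) := by
    intro r j; rw [hH, hH]; push_cast; omega
  simp only [key]
  clear_value H
  clear key hH per per'
  obtain ⟨r0, -, hr0⟩ := Finset.exists_min_image (Finset.range (N + 1)) H ⟨0, by simp⟩
  have hex : ∃ r, ∀ i ≤ N, H r ≤ H i := ⟨r0, fun i hi => hr0 i (by simp; omega)⟩
  classical
  have hr0mem : ∃ r, r ≤ N ∧ ∀ i ≤ N, H r ≤ H i := by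
    obtain ⟨r0, h, hr0⟩ := Finset.exists_min_image (Finset.range (N + 1)) H ⟨0, by simp⟩
    exact ⟨r0, by simp at h; omega, fun i hi => hr0 i (by simp; omega)⟩
  have h1 := Nat.find_spec hr0mem
  have h2 := fun m => Nat.find_min (m := m) hr0mem
  generalize Nat.find hr0mem = r at h1 h2
  have h3 : ∀ m < r, H r < H m := by
    intro m hm
    by_contra hc
    exact h2 m hm ⟨by omega, fun i hi => le_trans (not_lt.mp hc) (h1.2 i hi)⟩
  refine ⟨⟨r, by omega⟩, ?_, ?_⟩
  · intro j hj
    simp only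
    by_cases hjr : r + j ≤ N
    · exact h1.2 _ hjr
    · obtain ⟨m, hm⟩ : ∃ m, r + j = m + (N + 1) := ⟨r + j - (N + 1), by omega⟩
      rw [hm, perH]
      have := h3 m (by omega)
      omega
  · have uniq : ∀ r r' : ℕ, r < r' → r' ≤ N → (∀ j ≤ N, H r ≤ H (r + j)) →
        (∀ j ≤ N, H r' ≤ H (r' + j)) → False := by
      intro r r' hlt hle a1 a2
      have b1 := a1 (r' - r) (by omega)
      have b2 := a2 (r + (N + 1) - r') (by omega)
      rw [show r + (r' - r) = r' by omega] at b1
      rw [show r' + (r + (N + 1) - r') = r + (N + 1) by omega, perH] at b2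
      omega
    intro r' hr'
    have hgood : ∀ j ≤ N, H r ≤ H (r + j) := by
      intro j hj
      by_cases hjr : r + j ≤ N
      · exact h1.2 _ hjr
      · obtain ⟨m, hm⟩ : ∃ m, r + j = m + (N + 1) := ⟨r + j - (N + 1), by omega⟩
        rw [hm, perH]
        have := h3 m (by omega)
        omega
    ext
    simp only
    rcases lt_trichotomy (r' : ℕ) r with h | h | h
    · exact (uniq _ _ h h1.1 hr' hgood).elim
    · exact h
    · exact (uniq _ _ h (by omega) hgood hr').elim

/-- All sequences with sum `n`. -/
def allF (k n : ℕ) : Finset (Fin (k * n + 1) → ℕ) := Finset.piAntidiag Finset.univ n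

lemma mem_allF (k n : ℕ) (a : Fin (k * n + 1) → ℕ) : a ∈ allF k n ↔ ∑ i, a i = n := by
  simp [allF]

lemma card_allF (k n : ℕ) : (allF k n).card = Nat.choose ((k + 1) * n) n := by
  classical
  have e := Sym.equivNatSumOfFintype (Fin (k * n + 1)) n
  have h1 : Fintype.card (Sym (Fin (k * n + 1)) n) = Nat.choose ((k + 1) * n) n := by
    rw [Sym.card_sym_eq_choose, Fintype.card_fin]
    congr 1
    rw [add_mul]; omega
  rw [← h1]
  have e2 : {P : Fin (k * n + 1) → ℕ // ∑ i, P i = n} ≃ {P // P ∈ allF k n} :=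
    Equiv.subtypeEquivRight fun P => (mem_allF k n P).symm
  have := Fintype.card_congr (e.trans e2)
  rw [this, Fintype.card_coe]

open Classical in
lemma card_goodF (k n : ℕ) :
    (k * n + 1) * ((allF k n).filter (fun a => goodF k a)).card = Nat.choose ((k + 1) * n) n := by
  rw [← card_allF]
  have h := Finset.sum_card_bipartiteAbove_eq_sum_card_bipartiteBelow
    (s := allF k n) (t := (Finset.univ : Finset (Fin (k * n + 1))))
    (fun a r => goodF k (rotF r a))
  have hl : ∀ a ∈ allF k n, (Finset.bipartiteAbove (fun a r => goodF k (rotF r a))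
      (Finset.univ : Finset (Fin (k * n + 1))) a).card = 1 := by
    intro a ha
    rw [mem_allF] at ha
    obtain ⟨r, hr, hu⟩ := existsUnique_good k n a ha
    rw [Finset.card_eq_one]
    refine ⟨r, ?_⟩
    ext r'
    simp only [Finset.mem_bipartiteAbove, Finset.mem_univ, true_and, Finset.mem_singleton]
    exact ⟨fun h => hu r' h, fun h => h ▸ hr⟩
  have hr : ∀ r ∈ (Finset.univ : Finset (Fin (k * n + 1))),
      (Finset.bipartiteBelow (fun a r => goodF k (rotF r a)) (allF k n) r).card
        = ((allF k n).filter (fun a => goodF k a)).card := by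
    intro r _
    refine Finset.card_bij (fun a _ => rotF r a) ?_ ?_ ?_
    · intro a ha
      simp only [Finset.mem_bipartiteBelow, Finset.mem_filter, mem_allF] at ha ⊢
      rw [sum_rot]; exact ha
    · intro a _ b _ hab
      funext i
      have := congrFun hab (i - r)
      simpa [rotF] using this
    · intro b hb
      have hrot : rotF r (rotF (-r) b) = b := by
        funext i; simp [rotF]
      refine ⟨rotF (-r) b, ?_, hrot⟩
      simp only [Finset.mem_bipartiteBelow, Finset.mem_filter, mem_allF] at hb ⊢
      rw [sum_rot, hrot]; exact hb
  rw [Finset.sum_congr rfl hl, Finset.sum_congr rfl hr] at h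
  simp at h
  rw [h]

/-- Height function of a sequence. -/
def hF (f : ℕ → ℕ) (j : ℕ) : ℕ := ∑ l ∈ Finset.range j, f l - j

/-- The opener of `i`. -/
def opF (f : ℕ → ℕ) (i : ℕ) : ℕ := Nat.findGreatest (fun j => hF f j ≤ hF f (i + 1)) i

lemma opF_le (f : ℕ → ℕ) (i : ℕ) : opF f i ≤ i := Nat.findGreatest_le i

lemma opF_h (f : ℕ → ℕ) (i : ℕ) : hF f (opF f i) ≤ hF f (i + 1) := by
  unfold opF
  exact Nat.findGreatest_spec (P := fun j => hF f j ≤ hF f (i + 1)) (m := 0) (Nat.zero_le _)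
    (by simp [hF])

lemma opF_lt (f : ℕ → ℕ) (i j : ℕ) (h1 : opF f i < j) (h2 : j ≤ i) :
    hF f (i + 1) < hF f j := by
  have := Nat.findGreatest_is_greatest h1 h2
  omega

lemma opF_unique (f : ℕ → ℕ) (i p : ℕ) (hp : p ≤ i) (h1 : hF f p ≤ hF f (i + 1))
    (h2 : ∀ j, p < j → j ≤ i → hF f (i + 1) < hF f j) : opF f i = p := by
  rcases lt_trichotomy (opF f i) p with h | h | h
  · have := opF_lt f i p h hp
    omega
  · exact h
  · have := h2 _ h (opF_le f i)
    have := opF_h f i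
    omega

lemma opF_opF (f : ℕ → ℕ) (i : ℕ) : opF f (opF f i) = opF f i := by
  refine opF_unique _ _ _ le_rfl ?_ (fun j h1 h2 => by omega)
  rcases (opF_le f i).eq_or_lt with h | h
  · have := opF_h f i
    rw [h] at this ⊢
    exact this
  · have := opF_lt f i (opF f i + 1) (by omega) (by omega)
    have := opF_h f i
    omega

lemma opF_nc (f : ℕ → ℕ) (a b c d : ℕ) (hab : a < b) (hbc : b < c) (hcd : c < d)
    (h1 : opF f a = opF f c) (h2 : opF f b = opF f d) : opF f a = opF f b := by
  have la := opF_le f a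
  have lb := opF_le f b
  rcases lt_trichotomy (opF f a) (opF f b) with h | h | h
  · have := opF_lt f c (opF f b) (by omega) (by omega)
    have := opF_lt f d (c + 1) (by omega) (by omega)
    have := opF_h f d
    rw [← h2] at this
    omega
  · exact h
  · have := opF_lt f b (opF f a) (by omega) (by omega)
    have := opF_lt f c (b + 1) (by omega) (by omega)
    have := opF_h f c
    rw [← h1] at this
    omega

lemma card_opF_fiber (f : ℕ → ℕ) (N : ℕ) (hf : ∀ j ≤ N, j ≤ ∑ l ∈ Finset.range j, f l)
    (htot : ∑ l ∈ Finset.range N, f l = N) :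
    ∀ l < N, ((Finset.range N).filter (fun x => opF f x = l)).card = f l := by
  have hstep : ∀ j < N, hF f (j + 1) + 1 = hF f j + f j := by
    intro j hj
    have a1 := hf j hj.le
    have a2 := hf (j + 1) hj
    unfold hF
    rw [Finset.sum_range_succ] at a2 ⊢
    omega
  have hle : ∀ l ∈ Finset.range N,
      ((Finset.range N).filter (fun x => opF f x = l)).card ≤ f l := by
    intro l hl
    have hl := Finset.mem_range.mp hl
    have : f l = (Finset.Ico (hF f l) (hF f l + f l)).card := by simp
    rw [this]
    refine Finset.card_le_card_of_injOn (fun x => hF f (x + 1)) ?_ ?_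
    · intro x hx
      simp only [Finset.coe_filter, Finset.mem_range, Set.mem_ofPred_eq] at hx
      simp only [Finset.coe_Ico, Set.mem_Ico]
      obtain ⟨hxN, rfl⟩ := hx
      refine ⟨opF_h f x, ?_⟩
      have s := hstep _ hl
      rcases (opF_le f x).eq_or_lt with h | h
      · rw [h] at s ⊢
        omega
      · have := opF_lt f x (opF f x + 1) (by omega) (by omega)
        omega
    · have aux : ∀ x y, opF f x = l → opF f y = l → x < y → hF f (x + 1) ≠ hF f (y + 1) := by
        intro x y hx hy hxy
        have := opF_le f x
        have := opF_lt f y (x + 1) (by omega) (by omega)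
        omega
      intro x hx y hy hxy
      simp only [Finset.coe_filter, Finset.mem_range, Set.mem_ofPred_eq] at hx hy hxy
      rcases lt_trichotomy x y with h | h | h
      · exact (aux x y hx.2 hy.2 h hxy).elim
      · exact h
      · exact (aux y x hy.2 hx.2 h hxy.symm).elim
  have hsum : ∑ l ∈ Finset.range N, ((Finset.range N).filter (fun x => opF f x = l)).card
      = ∑ l ∈ Finset.range N, f l := by
    rw [htot, ← Finset.card_eq_sum_card_fiberwise]
    · simp
    · intro x hx
      have := opF_le f x
      simp at hx ⊢
      omega
  have := (Finset.sum_eq_sum_iff_of_le hle).mp hsum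
  intro l hl
  exact this l (by simpa using hl)

/-- Minimum of the block of `x`. -/
def mF {N : ℕ} (π : Finpartition (Finset.univ : Finset (Fin N))) (x : Fin N) : Fin N :=
  (π.part x).min' ⟨x, by simp⟩

lemma mF_mem {N : ℕ} (π : Finpartition (Finset.univ : Finset (Fin N))) (x : Fin N) :
    mF π x ∈ π.part x := Finset.min'_mem _ _

lemma mF_le {N : ℕ} (π : Finpartition (Finset.univ : Finset (Fin N))) (x : Fin N) :
    mF π x ≤ x := Finset.min'_le _ _ (by simp)

lemma part_mF {N : ℕ} (π : Finpartition (Finset.univ : Finset (Fin N))) (x : Fin N) :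
    π.part (mF π x) = π.part x :=
  (π.mem_part_iff_part_eq_part (by simp) (by simp)).mp (mF_mem π x)

lemma part_eq_iff {N : ℕ} (π : Finpartition (Finset.univ : Finset (Fin N))) (x y : Fin N) :
    π.part x = π.part y ↔ mF π x = mF π y := by
  constructor
  · intro h
    simp only [mF, h]
  · intro h
    rw [← part_mF π x, h, part_mF]

lemma mF_mF {N : ℕ} (π : Finpartition (Finset.univ : Finset (Fin N))) (x : Fin N) :
    mF π (mF π x) = mF π x := (part_eq_iff π _ _).mp (part_mF π x)

lemma mem_part_iff_mF {N : ℕ} (π : Finpartition (Finset.univ : Finset (Fin N))) (x y : Fin N) :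
    y ∈ π.part x ↔ mF π y = mF π x := by
  rw [← part_eq_iff, π.mem_part_iff_part_eq_part (by simp) (by simp)]

lemma nc_iff {N : ℕ} (π : Finpartition (Finset.univ : Finset (Fin N))) :
    IsNoncrossing π ↔ ∀ a b c d : Fin N, a < b → b < c → c < d → mF π a = mF π c →
      mF π b = mF π d → mF π a = mF π b := by
  unfold IsNoncrossing
  refine forall₄_congr fun a b c d => ?_
  refine forall₃_congr fun _ _ _ => ?_
  constructor
  · intro h h1 h2
    rw [← part_eq_iff]
    refine h _ (by simp) _ (by simp) (by simp) ?_ (by simp) ?_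
    · rw [mem_part_iff_mF, h1]
    · rw [mem_part_iff_mF, h2]
  · intro h B hB C hC ha hc hb hd
    have ea := π.part_eq_of_mem hB ha
    have ec := π.part_eq_of_mem hB hc
    have eb := π.part_eq_of_mem hC hb
    have ed := π.part_eq_of_mem hC hd
    have := h ((part_eq_iff _ _ _).mp (ea.trans ec.symm)) ((part_eq_iff _ _ _).mp (eb.trans ed.symm))
    rw [← part_eq_iff, ea, eb] at this
    exact this

lemma eq_of_mF {N : ℕ} (π π' : Finpartition (Finset.univ : Finset (Fin N)))
    (h : ∀ x, mF π x = mF π' x) : π = π' := by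
  have hp : ∀ x, π.part x = π'.part x := by
    intro x
    ext y
    rw [mem_part_iff_mF, mem_part_iff_mF, h, h]
  have key : ∀ (ρ : Finpartition (Finset.univ : Finset (Fin N))) (B : Finset (Fin N)),
      B ∈ ρ.parts ↔ ∃ x, ρ.part x = B := by
    intro ρ B
    constructor
    · intro hB
      obtain ⟨x, hx⟩ := ρ.nonempty_of_mem_parts hB
      exact ⟨x, ρ.part_eq_of_mem hB hx⟩
    · rintro ⟨x, rfl⟩
      simp
  ext B
  rw [key, key]
  simp only [hp]

/-- Fiber sizes of the block-minimum map. -/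
def cF {N : ℕ} (π : Finpartition (Finset.univ : Finset (Fin N))) (l : ℕ) : ℕ :=
  ((Finset.univ : Finset (Fin N)).filter (fun x => (mF π x : ℕ) = l)).card

lemma card_part_eq {N : ℕ} (π : Finpartition (Finset.univ : Finset (Fin N))) (x : Fin N) :
    (π.part x).card = cF π (mF π x) := by
  unfold cF
  congr 1
  ext y
  simp [mem_part_iff_mF, Fin.ext_iff]

lemma dvd_iff {N : ℕ} (π : Finpartition (Finset.univ : Finset (Fin N))) (k : ℕ) :
    (∀ B ∈ π.parts, k ∣ B.card) ↔ ∀ l, k ∣ cF π l := by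
  constructor
  · intro h l
    by_cases hl : ∃ x, (mF π x : ℕ) = l
    · obtain ⟨x, rfl⟩ := hl
      rw [← card_part_eq]
      exact h _ (by simp)
    · have : cF π l = 0 := by
        unfold cF
        rw [Finset.card_eq_zero, Finset.filter_eq_empty_iff]
        intro x _ hx
        exact hl ⟨x, hx⟩
      simp [this]
  · intro h B hB
    obtain ⟨x, hx⟩ := π.nonempty_of_mem_parts hB
    rw [← π.part_eq_of_mem hB hx, card_part_eq]
    exact h _

lemma cF_eq_zero {N : ℕ} (π : Finpartition (Finset.univ : Finset (Fin N))) (l : ℕ) (hl : N ≤ l) :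
    cF π l = 0 := by
  unfold cF
  rw [Finset.card_eq_zero, Finset.filter_eq_empty_iff]
  intro x _ hx
  omega

lemma sum_cF {N : ℕ} (π : Finpartition (Finset.univ : Finset (Fin N))) (j : ℕ) :
    ∑ l ∈ Finset.range j, cF π l
      = ((Finset.univ : Finset (Fin N)).filter (fun x => (mF π x : ℕ) < j)).card := by
  rw [Finset.card_eq_sum_card_fiberwise (f := fun x => (mF π x : ℕ)) (t := Finset.range j)]
  · refine Finset.sum_congr rfl fun l hl => ?_
    unfold cF
    congr 1
    ext x
    simp at hl ⊢
    omega
  · intro x hx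
    simpa using hx

lemma sum_cF_eq {N : ℕ} (π : Finpartition (Finset.univ : Finset (Fin N))) (j : ℕ) (hj : j ≤ N) :
    ∑ l ∈ Finset.range j, cF π l
      = j + ((Finset.univ : Finset (Fin N)).filter
        (fun x => (mF π x : ℕ) < j ∧ j ≤ (x : ℕ))).card := by
  rw [sum_cF, ← Finset.card_filter_add_card_filter_not (fun x : Fin N => (x : ℕ) < j),
    Finset.filter_filter, Finset.filter_filter]
  congr 1
  · have : (Finset.univ.filter (fun x : Fin N => (mF π x : ℕ) < j ∧ (x : ℕ) < j))
        = Finset.univ.filter (fun x : Fin N => (x : ℕ) < j) := by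
      ext x
      have : (mF π x : ℕ) ≤ x := mF_le π x
      simp
      omega
    rw [this, Fin.card_filter_val_lt]
    omega
  · simp only [not_lt]

lemma hF_cF {N : ℕ} (π : Finpartition (Finset.univ : Finset (Fin N))) (j : ℕ) (hj : j ≤ N) :
    hF (cF π) j = ((Finset.univ : Finset (Fin N)).filter
        (fun x => (mF π x : ℕ) < j ∧ j ≤ (x : ℕ))).card := by
  unfold hF
  rw [sum_cF_eq π j hj]
  omega

lemma opF_cF {N : ℕ} (π : Finpartition (Finset.univ : Finset (Fin N))) (hπ : IsNoncrossing π)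
    (i : Fin N) : opF (cF π) i = mF π i := by
  rw [nc_iff] at hπ
  have hmi : (mF π i : ℕ) ≤ i := mF_le π i
  refine opF_unique _ _ _ hmi ?_ ?_
  · rw [hF_cF _ _ (by omega), hF_cF _ _ (by omega)]
    refine Finset.card_le_card ?_
    intro x hx
    simp only [Finset.mem_filter, Finset.mem_univ, true_and] at hx ⊢
    refine ⟨by omega, ?_⟩
    by_contra hc
    have h1 : x ≠ i := by rintro rfl; omega
    have h2 : x ≠ mF π i := by
      rintro rfl
      rw [mF_mF] at hx
      omega
    have := hπ (mF π x) (mF π i) x i (by omega) (by omega) (by omega) (mF_mF π x) (mF_mF π i)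
    rw [mF_mF, mF_mF] at this
    rw [this] at hx
    omega
  · intro j hj1 hj2
    rw [hF_cF _ _ (by omega), hF_cF _ _ (by omega)]
    refine Finset.card_lt_card ?_
    rw [Finset.ssubset_iff_of_subset]
    · refine ⟨i, ?_, ?_⟩
      · simp only [Finset.mem_filter, Finset.mem_univ, true_and]
        omega
      · simp
    · intro x hx
      simp only [Finset.mem_filter, Finset.mem_univ, true_and] at hx ⊢
      refine ⟨?_, by omega⟩
      by_contra hc
      have h1 : mF π x ≠ i := by
        intro h
        have := mF_mF π x
        rw [h] at this
        rw [this] at hj1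
        omega
      have := hπ (mF π i) (mF π x) i x (by omega) (by omega) (by omega) (mF_mF π i) (mF_mF π x)
      rw [mF_mF, mF_mF] at this
      rw [this] at hj1
      omega

/-- The sequence of a partition. -/
def phiF (k : ℕ) {N : ℕ} (π : Finpartition (Finset.univ : Finset (Fin N))) : Fin (N + 1) → ℕ :=
  fun l => cF π l / k

lemma psum_phiF (k : ℕ) {N : ℕ} (π : Finpartition (Finset.univ : Finset (Fin N)))
    (hd : ∀ l, k ∣ cF π l) (j : ℕ) (hj : j ≤ N + 1) :
    k * psum (phiF k π) j = ∑ l ∈ Finset.range j, cF π l := by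
  unfold psum phiF
  rw [Finset.mul_sum]
  refine Finset.sum_congr rfl fun l hl => ?_
  have hl := Finset.mem_range.mp hl
  rw [Nat.mul_div_cancel' (hd _)]
  congr 1
  simp
  omega

open Classical in
lemma exists_partition_s1 (k n : ℕ) (hk : 1 ≤ k) (g : Fin (k * n + 1) → ℕ) (hg : ∑ i, g i = n)
    (hgood : goodF k g) : ∃ π ∈ NCdiv k n, phiF k π = g := by
  set f : ℕ → ℕ := fun l => k * g (Fin.ofNat (k * n + 1) l) with hfdef
  have hps : ∀ j, ∑ l ∈ Finset.range j, f l = k * psum g j := by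
    intro j
    rw [psum, Finset.mul_sum]
  have hfull : psum g (k * n) + g (Fin.ofNat (k * n + 1) (k * n)) = n := by
    have h := psum_full g
    rw [hg, psum, Finset.sum_range_succ] at h
    exact h
  have hle := hgood (k * n) le_rfl
  have hge : n ≤ psum g (k * n) := Nat.le_of_mul_le_mul_left hle hk
  have htot : ∑ l ∈ Finset.range (k * n), f l = k * n := by
    rw [hps]
    congr 1
    omega
  have hlast : g (Fin.ofNat (k * n + 1) (k * n)) = 0 := by omega
  have hfib := card_opF_fiber f (k * n) (fun j hj => by rw [hps]; exact hgood j hj) htot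
  let s : Setoid (Fin (k * n)) := Setoid.ker (fun x : Fin (k * n) => opF f x)
  let π : Finpartition (Finset.univ : Finset (Fin (k * n))) := Finpartition.ofSetoid s
  have hmem : ∀ x y, y ∈ π.part x ↔ opF f x = opF f y := fun x y =>
    Finpartition.mem_part_ofSetoid_iff_rel
  have hm : ∀ x, (mF π x : ℕ) = opF f x := by
    intro x
    have hx := opF_le f x
    apply le_antisymm
    · have : (⟨opF f x, by omega⟩ : Fin (k * n)) ∈ π.part x := by
        rw [hmem]
        exact (opF_opF f x).symm
      exact Finset.min'_le _ _ this
    · have := (hmem x _).mp (mF_mem π x)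
      rw [this]
      exact opF_le f _
  have hc : ∀ l < k * n, cF π l = f l := by
    intro l hl
    rw [← hfib l hl]
    unfold cF
    simp only [hm]
    refine Finset.card_bij (fun x _ => (x : ℕ)) ?_ ?_ ?_
    · intro x hx
      simpa using hx
    · intro x _ y _ h
      exact Fin.ext h
    · intro x hx
      simp only [Finset.mem_filter, Finset.mem_range] at hx
      exact ⟨⟨x, hx.1⟩, by simpa using hx.2, rfl⟩
  refine ⟨π, ?_, ?_⟩
  · simp only [NCdiv, fil, Finset.mem_filter, Finset.mem_univ, true_and]
    refine ⟨?_, ?_⟩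
    · rw [nc_iff]
      intro a b c d hab hbc hcd
      simp only [Fin.ext_iff, hm]
      exact opF_nc f a b c d hab hbc hcd
    · rw [dvd_iff]
      intro l
      by_cases hl : l < k * n
      · rw [hc l hl]
        exact Dvd.intro _ rfl
      · rw [cF_eq_zero _ _ (by omega)]
        simp
  · funext l
    unfold phiF
    by_cases hl : (l : ℕ) < k * n
    · rw [hc _ hl]
      simp only [hfdef]
      rw [Nat.mul_div_cancel_left _ (by omega)]
      congr 1
      ext
      simp
    · rw [cF_eq_zero _ _ (by omega)]
      have : l = Fin.ofNat (k * n + 1) (k * n) := by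
        ext
        simp
        omega
      rw [this, hlast]
      simp

/-- The number of `k`-divisible non-crossing partitions of `{1,…,kn}` is
`binom((k+1)n, n) / (kn + 1)`. -/
theorem card_k_divisible_noncrossing (n k : ℕ) (hn : 1 ≤ n) (hk : 1 ≤ k) :
    (k * n + 1) * (NCdiv k n).card = Nat.choose ((k + 1) * n) n := by
  classical
  rw [← card_goodF k n]
  congr 1
  have hmem : ∀ π ∈ NCdiv k n, IsNoncrossing π ∧ ∀ l, k ∣ cF π l := by
    intro π hπ
    simp only [NCdiv, fil, Finset.mem_filter, Finset.mem_univ, true_and] at hπ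
    rw [dvd_iff] at hπ
    exact hπ
  refine Finset.card_bij (fun π _ => phiF k π) ?_ ?_ ?_
  · intro π hπ
    obtain ⟨-, hd⟩ := hmem π hπ
    rw [Finset.mem_filter, mem_allF]
    constructor
    · rw [← psum_full]
      have h1 := psum_phiF k π hd (k * n + 1) le_rfl
      rw [Finset.sum_range_succ, cF_eq_zero _ _ le_rfl, sum_cF] at h1
      have h2 : (Finset.univ.filter (fun x : Fin (k * n) => (mF π x : ℕ) < k * n))
          = Finset.univ := by
        ext x
        simp
      rw [h2, Finset.card_univ, Fintype.card_fin, add_zero] at h1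
      exact Nat.eq_of_mul_eq_mul_left hk h1
    · intro j hj
      rw [psum_phiF k π hd j (by omega), sum_cF_eq π j hj]
      omega
  · intro π hπ π' hπ' h
    obtain ⟨hn1, hd⟩ := hmem π hπ
    obtain ⟨hn2, hd'⟩ := hmem π' hπ'
    have hc : cF π = cF π' := by
      funext l
      by_cases hl : l < k * n
      · have := congrFun h ⟨l, by omega⟩
        simp only [phiF] at this
        rw [← Nat.mul_div_cancel' (hd l), this, Nat.mul_div_cancel' (hd' l)]
      · rw [cF_eq_zero _ _ (by omega), cF_eq_zero _ _ (by omega)]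
    refine eq_of_mF _ _ fun x => ?_
    ext
    rw [← opF_cF π hn1, ← opF_cF π' hn2, hc]
  · intro g hg
    rw [Finset.mem_filter, mem_allF] at hg
    obtain ⟨π, h1, h2⟩ := exists_partition_s1 k n hk g hg.1 hg.2
    exact ⟨π, h1, h2⟩
end

section
/- For all integers n ≥ 1 and k ≥ 1, the number of elements of NC_k(n) equals binom(kn, n)/((k−1)n+1); equivalently, ((k−1)n+1)·#NC_k(n) = binom(kn, n). -/
open Finset

structure GoodConf (k m : ℕ) (P : Finset (Finset ℕ)) : Prop where
  sub : ∀ B ∈ P, ∀ x ∈ B, x < m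
  crd : ∀ B ∈ P, B.card = k
  dis : ∀ B ∈ P, ∀ C ∈ P, ∀ x, x ∈ B → x ∈ C → B = C
  ncr : ∀ a b c d : ℕ, a < b → b < c → c < d →
    ∀ B ∈ P, ∀ C ∈ P, a ∈ B → c ∈ B → b ∈ C → d ∈ C → B = C
  opn : ∀ B ∈ P, ∀ a x c : ℕ, a < x → x < c → a ∈ B → c ∈ B → ∃ C ∈ P, x ∈ C

noncomputable def Conf (k m b : ℕ) : Finset (Finset (Finset ℕ)) :=
  fil (range m).powerset.powerset (fun P => GoodConf k m P ∧ P.card = b)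

theorem mem_Conf {k m b : ℕ} {P : Finset (Finset ℕ)} :
    P ∈ Conf k m b ↔ GoodConf k m P ∧ P.card = b := by
  unfold Conf
  rw [mem_fil]
  constructor
  · exact fun h => h.2
  · intro h
    refine ⟨?_, h⟩
    simp only [mem_powerset]
    intro B hB
    simp only [mem_powerset]
    intro x hx
    exact mem_range.2 (h.1.sub B hB x hx)

theorem GoodConf.card_union {k m : ℕ} {P : Finset (Finset ℕ)} (h : GoodConf k m P) :
    (P.biUnion id).card = k * P.card := by
  rw [Finset.card_biUnion]
  · simp only [id]
    rw [Finset.sum_congr rfl (fun B hB => h.crd B hB)]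
    simp [mul_comm]
  · intro B hB C hC hne
    rw [Function.onFun, Finset.disjoint_left]
    intro x hx hx'
    exact hne (h.dis B hB C hC x hx hx')

theorem GoodConf.union_sub {k m : ℕ} {P : Finset (Finset ℕ)} (h : GoodConf k m P) :
    P.biUnion id ⊆ range m := by
  intro x hx
  simp only [mem_biUnion, id] at hx
  obtain ⟨B, hB, hx⟩ := hx
  exact mem_range.2 (h.sub B hB x hx)

theorem GoodConf.le {k m : ℕ} {P : Finset (Finset ℕ)} (h : GoodConf k m P) :
    k * P.card ≤ m := by
  rw [← h.card_union]
  simpa using card_le_card h.union_sub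

theorem exists_upper (p : ℕ) : ∀ O : Finset ℕ, p ≤ O.card →
    ∃ T ⊆ O, T.card = p ∧ ∀ x ∈ O, x ∉ T → ∀ t ∈ T, x < t := by
  induction p with
  | zero => intro O _; exact ⟨∅, by simp, by simp, by simp⟩
  | succ p ih =>
    intro O hO
    obtain ⟨T, hT, hc, hu⟩ := ih O (by omega)
    have hne : (O \ T).Nonempty := by
      rw [← Finset.card_pos, Finset.card_sdiff_of_subset hT]; omega
    have hmem := Finset.max'_mem (O \ T) hne
    set y := (O \ T).max' hne with hy
    rw [mem_sdiff] at hmem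
    refine ⟨insert y T, ?_, ?_, ?_⟩
    · exact insert_subset hmem.1 hT
    · rw [card_insert_of_notMem hmem.2, hc]
    · intro x hx hxT t ht
      rw [mem_insert, not_or] at hxT
      rcases mem_insert.1 ht with rfl | ht
      · exact lt_of_le_of_ne (Finset.le_max' _ _ (mem_sdiff.2 ⟨hx, hxT.2⟩)) hxT.1
      · exact hu x hx hxT.2 t ht

theorem upper_subset {O T T' : Finset ℕ} (hT : T ⊆ O) (hT' : T' ⊆ O) (hc : T.card = T'.card)
    (hu : ∀ x ∈ O, x ∉ T → ∀ t ∈ T, x < t) (hu' : ∀ x ∈ O, x ∉ T' → ∀ t ∈ T', x < t) :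
    T = T' := by
  by_contra hne
  have h1 : ¬ T ⊆ T' := fun h => hne (eq_of_subset_of_card_le h hc.ge)
  have h2 : ¬ T' ⊆ T := fun h => hne (eq_of_subset_of_card_le h hc.le).symm
  obtain ⟨x, hx, hx'⟩ := Finset.not_subset.1 h1
  obtain ⟨y, hy, hy'⟩ := Finset.not_subset.1 h2
  have := hu' x (hT hx) hx' y hy
  have := hu y (hT' hy) hy' x hx
  omega

/-- The elements not covered. -/
def opens (m : ℕ) (P : Finset (Finset ℕ)) : Finset ℕ := range m \ P.biUnion id

theorem mem_opens {m : ℕ} {P : Finset (Finset ℕ)} {x : ℕ} :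
    x ∈ opens m P ↔ x < m ∧ ∀ B ∈ P, x ∉ B := by
  simp [opens]

theorem GoodConf.card_opens {k m : ℕ} {P : Finset (Finset ℕ)} (h : GoodConf k m P) :
    (opens m P).card = m - k * P.card := by
  rw [opens, card_sdiff_of_subset h.union_sub, h.card_union, card_range]

theorem GoodConf.erase {k m : ℕ} {P : Finset (Finset ℕ)} {B : Finset ℕ}
    (h : GoodConf k (m + 1) P) (hB : B ∈ P) (hm : m ∈ B) : GoodConf k m (P.erase B) := by
  refine ⟨?_, ?_, ?_, ?_, ?_⟩
  · intro C hC x hx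
    rw [mem_erase] at hC
    have h1 := h.sub C hC.2 x hx
    have : x ≠ m := by
      rintro rfl
      exact hC.1 (h.dis C hC.2 B hB x hx hm)
    omega
  · intro C hC
    exact h.crd C (mem_of_mem_erase hC)
  · intro C hC D hD
    exact h.dis C (mem_of_mem_erase hC) D (mem_of_mem_erase hD)
  · intro a b c d h1 h2 h3 C hC D hD
    exact h.ncr a b c d h1 h2 h3 C (mem_of_mem_erase hC) D (mem_of_mem_erase hD)
  · intro C hC a x c h1 h2 ha hc
    rw [mem_erase] at hC
    obtain ⟨D, hD, hx⟩ := h.opn C hC.2 a x c h1 h2 ha hc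
    refine ⟨D, ?_, hx⟩
    rw [mem_erase]
    refine ⟨?_, hD⟩
    rintro rfl
    have hcm : c < m := by
      have h3 := h.sub C hC.2 c hc
      have : c ≠ m := by
        rintro rfl
        exact hC.1 (h.dis C hC.2 D hB c hc hm)
      omega
    exact hC.1 (h.ncr a x c m h1 h2 hcm C hC.2 D hD ha hc hx hm)

theorem GoodConf.upper {k m : ℕ} {P : Finset (Finset ℕ)} {B : Finset ℕ}
    (h : GoodConf k (m + 1) P) (hB : B ∈ P) (hm : m ∈ B) :
    B.erase m ⊆ opens m (P.erase B) ∧ (B.erase m).card = k - 1 ∧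
    ∀ x ∈ opens m (P.erase B), x ∉ B.erase m → ∀ t ∈ B.erase m, x < t := by
  refine ⟨?_, ?_, ?_⟩
  · intro x hx
    rw [mem_erase] at hx
    rw [mem_opens]
    constructor
    · have := h.sub B hB x hx.2
      omega
    · intro C hC hxC
      rw [mem_erase] at hC
      exact hC.1 (h.dis C hC.2 B hB x hxC hx.2)
  · rw [card_erase_of_mem hm, h.crd B hB]
  · intro x hx hxB t ht
    rw [mem_opens] at hx
    rw [mem_erase] at ht
    by_contra hlt
    have hxB' : x ∉ B := fun hb => hxB (mem_erase.2 ⟨by omega, hb⟩)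
    have hne : t ≠ x := by
      rintro rfl
      exact hxB' ht.2
    obtain ⟨C, hC, hxC⟩ := h.opn B hB t x m (by omega) hx.1 ht.2 hm
    refine hx.2 C (mem_erase.2 ⟨?_, hC⟩) hxC
    rintro rfl
    exact hxB' hxC

theorem GoodConf.insert_top {k m : ℕ} {Q : Finset (Finset ℕ)} {T : Finset ℕ} (hk : 1 ≤ k)
    (h : GoodConf k m Q) (hT : T ⊆ opens m Q) (hc : T.card = k - 1)
    (hu : ∀ x ∈ opens m Q, x ∉ T → ∀ t ∈ T, x < t) :
    GoodConf k (m + 1) (insert (insert m T) Q) := by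
  have hTm : ∀ x ∈ T, x < m := fun x hx => (mem_opens.1 (hT hx)).1
  have hTQ : ∀ x ∈ T, ∀ B ∈ Q, x ∉ B := fun x hx => (mem_opens.1 (hT hx)).2
  have hmT : m ∉ T := fun hm => lt_irrefl _ (hTm m hm)
  have hIQ : ∀ x ∈ insert m T, ∀ B ∈ Q, x ∉ B := by
    intro x hx B hB hxB
    rcases mem_insert.1 hx with rfl | hx
    · exact lt_irrefl _ (h.sub B hB _ hxB)
    · exact hTQ x hx B hB hxB
  have hIm : ∀ x ∈ insert m T, x < m + 1 := by
    intro x hx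
    rcases mem_insert.1 hx with rfl | hx
    · omega
    · have := hTm x hx
      omega
  refine ⟨?_, ?_, ?_, ?_, ?_⟩
  · intro B hB x hx
    rcases mem_insert.1 hB with rfl | hB
    · exact hIm x hx
    · have := h.sub B hB x hx
      omega
  · intro B hB
    rcases mem_insert.1 hB with rfl | hB
    · rw [card_insert_of_notMem hmT, hc]
      omega
    · exact h.crd B hB
  · intro B hB C hC x hx hx'
    rcases mem_insert.1 hB with rfl | hB <;> rcases mem_insert.1 hC with rfl | hC
    · rfl
    · exact absurd hx' (hIQ x hx C hC)
    · exact absurd hx (hIQ x hx' B hB)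
    · exact h.dis B hB C hC x hx hx'
  · intro a b c d h1 h2 h3 B hB C hC ha hc hb hd
    rcases mem_insert.1 hB with rfl | hB <;> rcases mem_insert.1 hC with rfl | hC
    · rfl
    · exfalso
      have hdm := h.sub C hC d hd
      have hcT : c ∈ T := mem_of_mem_insert_of_ne hc (by omega)
      obtain ⟨D, hD, hcD⟩ := h.opn C hC b c d h2 h3 hb hd
      exact hTQ c hcT D hD hcD
    · exfalso
      have hcm := h.sub B hB c hc
      have hbT : b ∈ T := mem_of_mem_insert_of_ne hb (by omega)
      obtain ⟨D, hD, hbD⟩ := h.opn B hB a b c h1 h2 ha hc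
      exact hTQ b hbT D hD hbD
    · exact h.ncr a b c d h1 h2 h3 B hB C hC ha hc hb hd
  · intro B hB a x c h1 h2 ha hc
    rcases mem_insert.1 hB with rfl | hB
    · have hcm := hIm c hc
      have haT : a ∈ T := mem_of_mem_insert_of_ne ha (by omega)
      by_contra hno
      push Not at hno
      have hxT : x ∉ T := fun hx => hno _ (mem_insert_self _ _) (mem_insert_of_mem hx)
      have hxo : x ∈ opens m Q :=
        mem_opens.2 ⟨by omega, fun D hD => hno D (mem_insert_of_mem hD)⟩
      have := hu x hxo hxT a haT
      omega
    · obtain ⟨D, hD, hx⟩ := h.opn B hB a x c h1 h2 ha hc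
      exact ⟨D, mem_insert_of_mem hD, hx⟩

theorem GoodConf.mono {k m : ℕ} {P : Finset (Finset ℕ)} :
    GoodConf k m P ↔ GoodConf k (m + 1) P ∧ ∀ B ∈ P, m ∉ B := by
  constructor
  · intro h
    exact ⟨⟨fun B hB x hx => (h.sub B hB x hx).trans (Nat.lt_succ_self m), h.crd, h.dis, h.ncr,
      h.opn⟩, fun B hB hm => lt_irrefl _ (h.sub B hB m hm)⟩
  · rintro ⟨h, hm⟩
    refine ⟨fun B hB x hx => ?_, h.crd, h.dis, h.ncr, h.opn⟩
    have h1 := h.sub B hB x hx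
    have : x ≠ m := by
      rintro rfl
      exact hm B hB hx
    omega

theorem filter_eq_erase {k m : ℕ} {P : Finset (Finset ℕ)} {B : Finset ℕ}
    (h : GoodConf k m P) {x : ℕ} (hB : B ∈ P) (hx : x ∈ B) :
    P.filter (fun C => x ∉ C) = P.erase B := by
  ext C
  simp only [mem_filter, mem_erase]
  constructor
  · rintro ⟨h1, h2⟩
    refine ⟨?_, h1⟩
    rintro rfl
    exact h2 hx
  · rintro ⟨h1, h2⟩
    exact ⟨h2, fun h3 => h1 (h.dis C h2 B hB x h3 hx)⟩

theorem Conf_rec (k m b : ℕ) (hk : 1 ≤ k) (hb : k * (b + 1) ≤ m + 1) :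
    (Conf k (m + 1) (b + 1)).card = (Conf k m (b + 1)).card + (Conf k m b).card := by
  classical
  rw [← Finset.card_filter_add_card_filter_not (s := Conf k (m + 1) (b + 1))
    (fun P => ∀ B ∈ P, m ∉ B)]
  congr 1
  · congr 1
    ext P
    simp only [mem_filter, mem_Conf]
    rw [GoodConf.mono (m := m)]
    tauto
  · apply Finset.card_bij (fun P _ => P.filter (fun C => m ∉ C))
    · intro P hP
      simp only [mem_filter, mem_Conf] at hP
      obtain ⟨⟨h, hc⟩, hex⟩ := hP
      push Not at hex
      obtain ⟨B, hB, hm⟩ := hex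
      rw [filter_eq_erase h hB hm, mem_Conf]
      refine ⟨h.erase hB hm, ?_⟩
      rw [card_erase_of_mem hB, hc]
      rfl
    · intro P hP P' hP' heq
      simp only [mem_filter, mem_Conf] at hP hP'
      obtain ⟨⟨h, hc⟩, hex⟩ := hP
      obtain ⟨⟨h', hc'⟩, hex'⟩ := hP'
      push Not at hex hex'
      obtain ⟨B, hB, hm⟩ := hex
      obtain ⟨B', hB', hm'⟩ := hex'
      rw [filter_eq_erase h hB hm, filter_eq_erase h' hB' hm'] at heq
      obtain ⟨u1, u2, u3⟩ := h.upper hB hm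
      obtain ⟨v1, v2, v3⟩ := h'.upper hB' hm'
      rw [← heq] at v1 v3
      have he := upper_subset u1 v1 (u2.trans v2.symm) u3 v3
      have hBB : B = B' := by
        rw [← insert_erase hm, ← insert_erase hm', he]
      rw [← insert_erase hB, ← insert_erase hB', heq, hBB]
    · intro Q hQ
      rw [mem_Conf] at hQ
      obtain ⟨h, hc⟩ := hQ
      obtain ⟨T, h1, h2, h3⟩ := exists_upper (k - 1) (opens m Q) (by
        rw [h.card_opens, hc]
        rw [mul_add] at hb
        omega)
      have hg := h.insert_top hk h1 h2 h3
      have hnm : ∀ B ∈ Q, m ∉ B := (GoodConf.mono.1 h).2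
      have hn : insert m T ∉ Q := fun hh => hnm _ hh (mem_insert_self _ _)
      refine ⟨insert (insert m T) Q, ?_, ?_⟩
      · simp only [mem_filter, mem_Conf]
        refine ⟨⟨hg, ?_⟩, ?_⟩
        · rw [card_insert_of_notMem hn, hc]
        · intro hh
          exact hh _ (mem_insert_self _ _) (mem_insert_self _ _)
      · rw [filter_eq_erase hg (mem_insert_self _ _) (mem_insert_self _ _)]
        exact erase_insert hn

theorem Conf_zero (k m : ℕ) : (Conf k m 0).card = 1 := by
  rw [card_eq_one]
  refine ⟨∅, ?_⟩
  ext P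
  rw [mem_Conf, mem_singleton, card_eq_zero]
  constructor
  · exact fun h => h.2
  · rintro rfl
    exact ⟨⟨by simp, by simp, by simp, by simp, by simp⟩, rfl⟩

theorem Conf_empty {k m b : ℕ} (h : m < k * b) : (Conf k m b).card = 0 := by
  rw [card_eq_zero, eq_empty_iff_forall_notMem]
  intro P hP
  rw [mem_Conf] at hP
  have := hP.1.le
  rw [hP.2] at this
  omega

theorem Conf_card (k : ℕ) (hk : 1 ≤ k) (m : ℕ) : ∀ b : ℕ, k * b ≤ m + 1 →
    ((m : ℤ) - b + 1) * (Conf k m b).card = ((m : ℤ) + 1 - k * b) * (m.choose b) := by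
  induction m with
  | zero =>
    intro b hb
    rcases Nat.eq_zero_or_pos b with rfl | hpos
    · simp [Conf_zero]
    · have h1 : 1 ≤ k * b := Nat.mul_pos hk hpos
      rw [Conf_empty (by omega)]
      rw [Nat.choose_eq_zero_of_lt hpos]
      simp
  | succ m ih =>
    intro b hb
    rcases b with _ | b
    · simp [Conf_zero]
    · rcases Nat.lt_or_ge (m + 1) (k * (b + 1)) with hlt | hge
      · rw [Conf_empty hlt]
        have : k * (b + 1) = m + 2 := by omega
        have h2 : (k : ℤ) * ((b : ℤ) + 1) = m + 2 := by exact_mod_cast this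
        push_cast
        rw [h2]
        ring
      · rw [Conf_rec k m b hk hge]
        have h1 := ih (b + 1) hge
        have h2 := ih b (by rw [mul_add] at hge; omega)
        have h3 := Nat.choose_succ_right_eq m b
        have hbm : b ≤ m := by
          have : b + 1 ≤ k * (b + 1) := Nat.le_mul_of_pos_left _ hk
          omega
        zify [hbm] at h3
        rw [Nat.choose_succ_succ']
        push_cast at *
        rcases Nat.eq_or_lt_of_le hbm with rfl | hlt
        · have hk1 : k = 1 := by
            have : k * (b + 1) ≤ 1 * (b + 1) := by omega
            have := Nat.le_of_mul_le_mul_right this (by omega)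
            omega
          subst hk1
          rw [Conf_empty (m := b) (b := b + 1) (by omega)]
          simp only [Nat.choose_self, Nat.choose_succ_self] at *
          push_cast at *
          linarith
        · have hne : ((m : ℤ) - b) ≠ 0 := by omega
          apply mul_left_cancel₀ hne
          linear_combination ((m : ℤ) - b + 1) * h1 + ((m : ℤ) - b) * h2 - ((k : ℤ) - 1) * h3

theorem NCeq_card (k n : ℕ) (hk : 1 ≤ k) : (NCeq k n).card = (Conf k (k * n) n).card := by
  classical
  have himg : Function.Injective
      (fun B : Finset (Fin (k * n)) => B.image Fin.val) :=
    Finset.image_injective Fin.val_injective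
  have hmem : ∀ (B : Finset (Fin (k * n))) (x : Fin (k * n)), x.val ∈ B.image Fin.val ↔ x ∈ B := by
    intro B x
    exact Fin.val_injective.mem_finset_image
  apply Finset.card_bij (fun π _ => π.parts.image (fun B => B.image Fin.val))
  · intro π hπ
    rw [NCeq, mem_fil] at hπ
    obtain ⟨-, hnc, hcard⟩ := hπ
    rw [mem_Conf]
    refine ⟨⟨?_, ?_, ?_, ?_, ?_⟩, ?_⟩
    · intro B hB x hx
      rw [mem_image] at hB
      obtain ⟨B, hB, rfl⟩ := hB
      rw [mem_image] at hx
      obtain ⟨x, hx, rfl⟩ := hx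
      exact x.2
    · intro B hB
      rw [mem_image] at hB
      obtain ⟨B, hB, rfl⟩ := hB
      rw [card_image_of_injective _ Fin.val_injective, hcard B hB]
    · intro B hB C hC x hx hx'
      rw [mem_image] at hB
      obtain ⟨B, hB, rfl⟩ := hB
      rw [mem_image] at hC
      obtain ⟨C, hC, rfl⟩ := hC
      rw [mem_image] at hx
      obtain ⟨x, hx, rfl⟩ := hx
      rw [hmem] at hx'
      rw [π.eq_of_mem_parts hB hC hx hx']
    · intro a b c d h1 h2 h3 B hB C hC ha hc hb hd
      rw [mem_image] at hB
      obtain ⟨B, hB, rfl⟩ := hB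
      rw [mem_image] at hC
      obtain ⟨C, hC, rfl⟩ := hC
      rw [mem_image] at ha
      obtain ⟨a, ha, rfl⟩ := ha
      rw [mem_image] at hb
      obtain ⟨b, hb, rfl⟩ := hb
      rw [mem_image] at hc
      obtain ⟨c, hc, rfl⟩ := hc
      rw [mem_image] at hd
      obtain ⟨d, hd, rfl⟩ := hd
      rw [hnc a b c d h1 h2 h3 B hB C hC ha hc hb hd]
    · intro B hB a x c h1 h2 ha hc
      rw [mem_image] at hB
      obtain ⟨B, hB, rfl⟩ := hB
      rw [mem_image] at hc
      obtain ⟨c, hc, rfl⟩ := hc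
      obtain ⟨C, hC, hx⟩ := π.exists_mem (mem_univ (⟨x, h2.trans c.2⟩ : Fin (k * n)))
      exact ⟨_, mem_image_of_mem _ hC, mem_image.2 ⟨_, hx, rfl⟩⟩
    · rw [card_image_of_injective _ himg]
      have h := π.sum_card_parts
      rw [Finset.sum_congr rfl hcard] at h
      simp only [sum_const, smul_eq_mul, card_univ, Fintype.card_fin] at h
      rw [mul_comm] at h
      exact Nat.eq_of_mul_eq_mul_left hk h
  · intro π _ π' _ heq
    exact Finpartition.ext (Finset.image_injective himg heq)
  · intro P hP
    rw [mem_Conf] at hP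
    obtain ⟨h, hc⟩ := hP
    have hcov : P.biUnion id = range (k * n) := by
      apply eq_of_subset_of_card_le h.union_sub
      rw [h.card_union, hc, card_range]
    let g : Finset ℕ → Finset (Fin (k * n)) := fun B => univ.filter (fun i => i.val ∈ B)
    have hg : ∀ B (x : Fin (k * n)), x ∈ g B ↔ x.val ∈ B := by
      intro B x
      simp [g]
    have hgi : ∀ B ∈ P, (g B).image Fin.val = B := by
      intro B hB
      ext x
      rw [mem_image]
      constructor
      · rintro ⟨y, hy, rfl⟩
        exact (hg B y).1 hy
      · intro hx
        exact ⟨⟨x, h.sub B hB x hx⟩, (hg B _).2 hx, rfl⟩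
    have hgc : ∀ B ∈ P, (g B).card = k := by
      intro B hB
      rw [← card_image_of_injective (g B) Fin.val_injective, hgi B hB]
      exact h.crd B hB
    let π : Finpartition (univ : Finset (Fin (k * n))) :=
      Finpartition.ofExistsUnique (P.image g) (fun B _ => subset_univ B) (by
        intro x _
        have hx : x.val ∈ P.biUnion id := by
          rw [hcov]
          exact mem_range.2 x.2
        simp only [mem_biUnion, id] at hx
        obtain ⟨B, hB, hx⟩ := hx
        refine ⟨g B, ⟨mem_image_of_mem g hB, (hg B x).2 hx⟩, ?_⟩
        rintro C ⟨hC, hxC⟩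
        rw [mem_image] at hC
        obtain ⟨C, hC, rfl⟩ := hC
        rw [h.dis C hC B hB x.val ((hg C x).1 hxC) hx]) (by
        intro he
        rw [mem_image] at he
        obtain ⟨B, hB, he⟩ := he
        have := hgc B hB
        rw [he, card_empty] at this
        omega)
    have hπ : π.parts = P.image g := rfl
    refine ⟨π, ?_, ?_⟩
    · rw [NCeq, mem_fil]
      refine ⟨mem_univ _, ?_, ?_⟩
      · intro a b c d h1 h2 h3 B hB C hC ha hc hb hd
        rw [hπ] at hB hC
        rw [mem_image] at hB
        obtain ⟨B, hB, rfl⟩ := hB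
        rw [mem_image] at hC
        obtain ⟨C, hC, rfl⟩ := hC
        rw [h.ncr a b c d h1 h2 h3 B hB C hC ((hg _ _).1 ha) ((hg _ _).1 hc)
          ((hg _ _).1 hb) ((hg _ _).1 hd)]
      · intro B hB
        rw [hπ] at hB
        rw [mem_image] at hB
        obtain ⟨B, hB, rfl⟩ := hB
        exact hgc B hB
    · rw [hπ, image_image]
      ext B
      rw [mem_image]
      constructor
      · rintro ⟨C, hC, rfl⟩
        rw [Function.comp, hgi C hC]
        exact hC
      · intro hB
        exact ⟨B, hB, hgi B hB⟩

/-- The number of `k`-equal non-crossing partitions of `{1,…,kn}` is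
`binom(kn, n) / ((k-1)n + 1)`. -/
theorem card_k_equal_noncrossing (n k : ℕ) (hn : 1 ≤ n) (hk : 1 ≤ k) :
    ((k - 1) * n + 1) * (NCeq k n).card = Nat.choose (k * n) n := by
  have h := Conf_card k hk (k * n) n (by omega)
  rw [NCeq_card k n hk]
  obtain ⟨p, rfl⟩ : ∃ p, k = p + 1 := ⟨k - 1, by omega⟩
  zify
  push_cast at *
  linear_combination h
end

section
/- For all integers n ≥ 1 and m ≥ 1, the sum of the multinomial coefficients m!/(r_1!·r_2!⋯r_n!) over all n-tuples of nonnegative integers (r_1, …, r_n) satisfying r_1 + r_2 + … + r_n = m and r_1 + 2r_2 + … + n·r_n = n equals binom(n−1, m−1). -/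
open Finset

open PowerSeries in
lemma geom_pow_coeff (n m k : ℕ) (hm : 1 ≤ m) (hk : k < n) :
    coeff k ((∑ i ∈ Finset.range n, (X : ℚ⟦X⟧) ^ i) ^ m) = Nat.choose (m - 1 + k) (m - 1) := by
  have h1 : (∑ i ∈ Finset.range n, (X : ℚ⟦X⟧) ^ i) ^ m
      = (1 - X ^ n) ^ m * (invOneSubPow ℚ m).val := by
    have h2 : (invOneSubPow ℚ m).inv = (1 - X) ^ m := invOneSubPow_inv_eq_one_sub_pow ℚ m
    have h3 := (invOneSubPow ℚ m).inv_val
    rw [h2] at h3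
    rw [← geom_sum_mul_neg, mul_pow, mul_assoc, h3, mul_one]
  have h4 : (X : ℚ⟦X⟧) ^ n ∣ (1 - X ^ n) ^ m - 1 := by
    have := sub_dvd_pow_sub_pow (1 - X ^ n : ℚ⟦X⟧) 1 m
    rw [one_pow] at this
    refine dvd_trans ⟨-1, by ring⟩ this
  obtain ⟨H, hH⟩ := h4
  have h5 : ((1 : ℚ⟦X⟧) - X ^ n) ^ m = 1 + X ^ n * H := by rw [← hH]; ring
  rw [h1, h5, add_mul, one_mul, mul_assoc, map_add, coeff_X_pow_mul', if_neg (by omega), add_zero,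
    invOneSubPow_val_eq_mk_sub_one_add_choose_of_pos ℚ m hm, coeff_mk]

/-- The sum of the multinomial coefficients `m!/(r_1! r_2! ⋯ r_n!)` over all `n`-tuples
of nonnegative integers with `r_1 + ⋯ + r_n = m` and `r_1 + 2 r_2 + ⋯ + n r_n = n`
equals `binom(n-1, m-1)`. -/
theorem sum_multinomial_eq_choose (n m : ℕ) (hn : 1 ≤ n) (hm : 1 ≤ m) :
    ∑ r ∈ (Finset.Nat.antidiagonalTuple n m).filter
        (fun r => ∑ i : Fin n, (i.val + 1) * r i = n),
      ((Nat.factorial m : ℚ) / ∏ i : Fin n, (Nat.factorial (r i) : ℚ)) =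
      Nat.choose (n - 1) (m - 1) := by
  have hL : ∀ r ∈ (Finset.Nat.antidiagonalTuple n m),
      (if ∑ i : Fin n, (i.val + 1) * r i = n then
        ((Nat.factorial m : ℚ) / ∏ i : Fin n, (Nat.factorial (r i) : ℚ)) else 0)
      = PowerSeries.coeff n ((Nat.multinomial Finset.univ r : PowerSeries ℚ) *
        ∏ i : Fin n, ((PowerSeries.X : PowerSeries ℚ) ^ (i.val + 1)) ^ r i) := by
    intro r hr
    rw [Finset.Nat.mem_antidiagonalTuple] at hr
    have hs := Nat.multinomial_spec Finset.univ r
    rw [hr] at hs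
    have hq : ((Nat.factorial m : ℚ) / ∏ i : Fin n, (Nat.factorial (r i) : ℚ))
        = (Nat.multinomial Finset.univ r : ℚ) := by
      rw [← hs]
      push_cast
      rw [mul_div_cancel_left₀]
      exact Finset.prod_ne_zero_iff.2 fun i _ => by positivity
    rw [hq]
    simp_rw [← pow_mul]
    rw [Finset.prod_pow_eq_pow_sum, ← nsmul_eq_mul, map_nsmul, PowerSeries.coeff_X_pow]
    simp [eq_comm]
  have hset : Finset.Nat.antidiagonalTuple n m = Finset.piAntidiag Finset.univ m := by
    ext r
    simp [Finset.Nat.mem_antidiagonalTuple]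
  rw [Finset.sum_filter, Finset.sum_congr rfl hL, ← map_sum, hset,
    ← Finset.sum_pow_eq_sum_piAntidiag,
    Fin.sum_univ_eq_sum_range (fun i => (PowerSeries.X : PowerSeries ℚ) ^ (i + 1)) n]
  simp_rw [pow_succ']
  rw [← Finset.mul_sum, mul_pow, PowerSeries.coeff_X_pow_mul']
  split_ifs with h
  · rw [geom_pow_coeff n m (n - m) hm (by omega)]
    congr 2
    omega
  · rw [Nat.choose_eq_zero_of_lt (by omega), Nat.cast_zero]
end
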